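/- arXiv:1710.02727 — 2 statements merged into one kernel-verified Lean document; each statement's English description precedes it below -/
import Mathlib

section
/- For all integers t, m ≥ 1 there exists an integer C ≥ 1 such that every finite graph with no K_{t,m} minor admits a (2t+2)-coloring with clustering C. -/
open SimpleGraph

/-- `S` is a `t`-island in `G`: a nonempty set of vertices each of which has
fewer than `t` neighbors outside `S`. -/
def IsIsland {V : Type*} (G : SimpleGraph V) (t : ℕ) (S : Set V) : Prop :=
  S.Nonempty ∧ ∀ v ∈ S, ((G.neighborSet v) \ S).ncard < t

/-- `H` is a minor of `G`: there is a model of `H` in `G`. -/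
def IsMinorOf {W V : Type*} (H : SimpleGraph W) (G : SimpleGraph V) : Prop :=
  ∃ μ : W → Set V,
    (∀ w, (μ w).Nonempty) ∧
    (∀ w, (G.induce (μ w)).Connected) ∧
    (Pairwise fun w₁ w₂ => Disjoint (μ w₁) (μ w₂)) ∧
    (∀ ⦃w₁ w₂⦄, H.Adj w₁ w₂ → ∃ u ∈ μ w₁, ∃ v ∈ μ w₂, G.Adj u v)

/-- The graph `I_n + P_m`: a path on `m` vertices together with `n` additional
pairwise non-adjacent vertices, each adjacent to every vertex of the path. -/
def IplusP (n m : ℕ) : SimpleGraph (Fin n ⊕ Fin m) :=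
  SimpleGraph.fromRel (fun a b =>
    (∃ i j, a = Sum.inl i ∧ b = Sum.inr j) ∨
    (∃ i j : Fin m, a = Sum.inr i ∧ b = Sum.inr j ∧ (i : ℕ) + 1 = (j : ℕ)))

/-- `c` is a coloring of `G` with clustering `C`: every monochromatic connected
subgraph has at most `C` vertices. -/
def ClusteredColoring {V α : Type*} (G : SimpleGraph V) (C : ℕ) (c : V → α) : Prop :=
  ∀ S : Set V, (G.induce S).Connected → (∀ u ∈ S, ∀ v ∈ S, c u = c v) → S.ncard ≤ C

/-- `G` has a tree decomposition of width at most `w`. -/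
def HasTreewidthAtMost {V : Type*} (G : SimpleGraph V) (w : ℕ) : Prop :=
  ∃ (n : ℕ) (T : SimpleGraph (Fin n)) (β : Fin n → Set V), T.IsTree ∧
    (∀ ⦃u v⦄, G.Adj u v → ∃ x, u ∈ β x ∧ v ∈ β x) ∧
    (∀ v : V, (T.induce {x | v ∈ β x}).Connected) ∧
    (∀ x, (β x).ncard ≤ w + 1)

/-- A class of graphs, given for each `n` as a collection of graphs on `Fin n`. -/
def MemClass (𝒢 : ∀ n : ℕ, SimpleGraph (Fin n) → Prop) {V : Type*} (G : SimpleGraph V) : Prop :=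
  ∃ (n : ℕ) (G' : SimpleGraph (Fin n)), 𝒢 n G' ∧ Nonempty (G ≃g G')

/-- `𝒢` is a (proper) minor-closed class. -/
def MinorClosed (𝒢 : ∀ n : ℕ, SimpleGraph (Fin n) → Prop) : Prop :=
  (∃ (n : ℕ) (G : SimpleGraph (Fin n)), ¬ 𝒢 n G) ∧
  ∀ ⦃n k : ℕ⦄ (G : SimpleGraph (Fin n)) (H : SimpleGraph (Fin k)),
    𝒢 n G → IsMinorOf H G → 𝒢 k H

/-- `𝒢` is closed under taking subgraphs (up to isomorphism). -/
def SubgraphClosed (𝒢 : ∀ n : ℕ, SimpleGraph (Fin n) → Prop) : Prop :=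
  ∀ ⦃n k : ℕ⦄ (G : SimpleGraph (Fin n)) (H : SimpleGraph (Fin k)), 𝒢 n G →
    (∃ f : Fin k → Fin n, Function.Injective f ∧ ∀ ⦃a b⦄, H.Adj a b → G.Adj (f a) (f b)) →
    𝒢 k H

/-- The vertices that eventually become active in bootstrap `t`-percolation
starting from the active set `A`. -/
inductive PercolationActive {V : Type*} (G : SimpleGraph V) (t : ℕ) (A : Set V) : V → Prop
  | base (v : V) : v ∈ A → PercolationActive G t A v
  | step (v : V) (N : Finset V) : t ≤ N.card → (∀ u ∈ N, G.Adj v u) →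
      (∀ u ∈ N, PercolationActive G t A u) → PercolationActive G t A v

/-- The set `A` `t`-percolates in `G`. -/
def Percolates {V : Type*} (G : SimpleGraph V) (t : ℕ) (A : Set V) : Prop :=
  ∀ v, PercolationActive G t A v

/-- `G` contains `k` pairwise disjoint `t`-islands. -/
def HasDisjointIslands {V : Type*} (G : SimpleGraph V) (t k : ℕ) : Prop :=
  ∃ f : Fin k → Set V, (∀ i, IsIsland G t (f i)) ∧ Pairwise (Function.onFun Disjoint f)

/-- `f` is significantly sublinear: `∑ f(⌈(3/2)^i⌉)/(3/2)^i` is finite. -/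
def SignificantlySublinear (f : ℕ → ℕ) : Prop :=
  Summable (fun i : ℕ => (f ⌈((3:ℝ)/2)^i⌉₊ : ℝ) / ((3:ℝ)/2)^i)

/-- The class `𝒢` has `f`-separators. -/
def HasSeparators (f : ℕ → ℕ) (𝒢 : ∀ n : ℕ, SimpleGraph (Fin n) → Prop) : Prop :=
  ∀ (n : ℕ) (G : SimpleGraph (Fin n)), 𝒢 n G →
    ∃ L R : G.Subgraph, L ⊔ R = ⊤ ∧ (L.verts ∩ R.verts).ncard ≤ f n ∧
      3 * (L.verts \ R.verts).ncard ≤ 2 * n ∧ 3 * (R.verts \ L.verts).ncard ≤ 2 * n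

/-- The number of edges of `G` with at least one end in `A`. -/
noncomputable def edgesTouching {V : Type*} (G : SimpleGraph V) (A : Set V) : ℕ :=
  {e ∈ G.edgeSet | ∃ v ∈ A, v ∈ e}.ncard


section Tools

variable {V W : Type*}

/-- The graph on the same vertex set keeping only the edges of `G` inside `S`. -/
def restrictTo (G : SimpleGraph V) (S : Set V) : SimpleGraph V where
  Adj a b := G.Adj a b ∧ a ∈ S ∧ b ∈ S
  symm := ⟨fun _ _ h => ⟨h.1.symm, h.2.2, h.2.1⟩⟩
  loopless := ⟨fun _ h => h.1.ne rfl⟩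

/-- Any two vertices of `K` are joined by a walk of `G` inside `K`. -/
def ReachConn (G : SimpleGraph V) (K : Set V) : Prop :=
  ∀ x ∈ K, ∀ y ∈ K, (restrictTo G K).Reachable x y

lemma restrictTo_le (G : SimpleGraph V) (S : Set V) : restrictTo G S ≤ G :=
  fun _ _ h => h.1

lemma restrictTo_mono {G H : SimpleGraph V} (h : G ≤ H) {S T : Set V} (hST : S ⊆ T) :
    restrictTo G S ≤ restrictTo H T :=
  fun _ _ hab => ⟨h hab.1, hST hab.2.1, hST hab.2.2⟩

lemma ReachConn.mono {G H : SimpleGraph V} (h : G ≤ H) {K : Set V} (hK : ReachConn G K) :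
    ReachConn H K :=
  fun x hx y hy => (hK x hx y hy).mono (restrictTo_mono h subset_rfl)

lemma reachConn_singleton (G : SimpleGraph V) (x : V) : ReachConn G {x} := by
  rintro a rfl b rfl
  exact Reachable.refl _

lemma reachConn_of_connected_induce {G : SimpleGraph V} {K : Set V}
    (h : (G.induce K).Connected) : ReachConn G K := by
  intro x hx y hy
  let f : G.induce K →g restrictTo G K := ⟨Subtype.val, fun {a b} hab => ⟨hab, a.2, b.2⟩⟩
  exact (h.preconnected ⟨x, hx⟩ ⟨y, hy⟩).map f

lemma ReachConn.connected_induce {G : SimpleGraph V} {K : Set V} (h : ReachConn G K)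
    (hne : K.Nonempty) : (G.induce K).Connected := by
  have key : ∀ x y, (restrictTo G K).Walk x y → ∀ (hx : x ∈ K) (hy : y ∈ K),
      (G.induce K).Reachable ⟨x, hx⟩ ⟨y, hy⟩ := by
    intro x y p
    induction p with
    | nil => intro _ _; exact Reachable.refl _
    | @cons u v w hadj p ih =>
      intro hx hy
      have h1 : (G.induce K).Adj ⟨u, hx⟩ ⟨v, hadj.2.2⟩ := hadj.1
      exact h1.reachable.trans (ih hadj.2.2 hy)
  rw [connected_iff]
  refine ⟨fun a b => ?_, hne.to_subtype⟩
  obtain ⟨p⟩ := h a a.2 b b.2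
  exact key _ _ p a.2 b.2

/-- Replacing the vertices of a connected set by adjacent connected sets. -/
lemma ReachConn.biUnion {G' : SimpleGraph W} {G : SimpleGraph V} {μ : W → Set V}
    (hconn : ∀ w, ReachConn G (μ w))
    (hadj : ∀ ⦃a b⦄, G'.Adj a b → ∃ u ∈ μ a, ∃ v ∈ μ b, G.Adj u v)
    {K : Set W} (hK : ReachConn G' K) : ReachConn G (⋃ w ∈ K, μ w) := by
  have hsub : ∀ w ∈ K, μ w ⊆ ⋃ w ∈ K, μ w := fun w hw => Set.subset_biUnion_of_mem hw
  have key : ∀ a b, (restrictTo G' K).Walk a b → a ∈ K → ∀ x ∈ μ a, ∀ y ∈ μ b,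
      (restrictTo G (⋃ w ∈ K, μ w)).Reachable x y := by
    intro a b p
    induction p with
    | @nil a =>
      intro ha x hx y hy
      exact (hconn a x hx y hy).mono (restrictTo_mono le_rfl (hsub a ha))
    | @cons a c b h p ih =>
      intro ha x hx y hy
      obtain ⟨u, hu, v, hv, huv⟩ := hadj h.1
      have h1 := (hconn a x hx u hu).mono (restrictTo_mono (le_refl G) (hsub a ha))
      have h2 : (restrictTo G (⋃ w ∈ K, μ w)).Adj u v :=
        ⟨huv, hsub a ha hu, hsub c h.2.2 hv⟩
      exact (h1.trans h2.reachable).trans (ih h.2.2 v hv y hy)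
  intro x hx y hy
  simp only [Set.mem_iUnion] at hx hy
  obtain ⟨a, ha, hxa⟩ := hx
  obtain ⟨b, hb, hyb⟩ := hy
  obtain ⟨p⟩ := hK a ha b hb
  exact key a b p ha x hxa y hyb

/-- The sets `T i` and `X j` form a model of a complete bipartite graph. -/
structure BipModel (G : SimpleGraph V) {t m : ℕ} (T : Fin t → Set V) (X : Fin m → Set V) :
    Prop where
  nonemptyT : ∀ i, (T i).Nonempty
  nonemptyX : ∀ j, (X j).Nonempty
  connT : ∀ i, ReachConn G (T i)
  connX : ∀ j, ReachConn G (X j)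
  disjT : Pairwise fun i j => Disjoint (T i) (T j)
  disjX : Pairwise fun i j => Disjoint (X i) (X j)
  disj : ∀ i j, Disjoint (T i) (X j)
  adj : ∀ i j, ∃ u ∈ T i, ∃ v ∈ X j, G.Adj u v

/-- `G` has a `K_{t,m}` minor, given by an explicit model. -/
def HasK (t m : ℕ) (G : SimpleGraph V) : Prop :=
  ∃ (T : Fin t → Set V) (X : Fin m → Set V), BipModel G T X

lemma HasK.isMinorOf {t m : ℕ} {G : SimpleGraph V} (h : HasK t m G) :
    IsMinorOf (completeBipartiteGraph (Fin t) (Fin m)) G := by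
  obtain ⟨T, X, h⟩ := h
  refine ⟨Sum.elim T X, ?_, ?_, ?_, ?_⟩
  · rintro (i | j)
    · exact h.nonemptyT i
    · exact h.nonemptyX j
  · rintro (i | j)
    · exact (h.connT i).connected_induce (h.nonemptyT i)
    · exact (h.connX j).connected_induce (h.nonemptyX j)
  · rintro (i | i) (j | j) hij
    · exact h.disjT (fun e => hij (by rw [e]))
    · exact h.disj i j
    · exact (h.disj j i).symm
    · exact h.disjX (fun e => hij (by rw [e]))
  · rintro (i | i) (j | j) hij
    · simp at hij
    · exact h.adj i j
    · obtain ⟨u, hu, v, hv, huv⟩ := h.adj j i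
      exact ⟨v, hv, u, hu, huv.symm⟩
    · simp at hij

lemma BipModel.biUnion {t m : ℕ} {G' : SimpleGraph W} {G : SimpleGraph V} {μ : W → Set V}
    (hne : ∀ w, (μ w).Nonempty) (hconn : ∀ w, ReachConn G (μ w))
    (hdisj : Pairwise fun a b => Disjoint (μ a) (μ b))
    (hadj : ∀ ⦃a b⦄, G'.Adj a b → ∃ u ∈ μ a, ∃ v ∈ μ b, G.Adj u v)
    {T : Fin t → Set W} {X : Fin m → Set W} (h : BipModel G' T X) :
    BipModel G (fun i => ⋃ w ∈ T i, μ w) (fun j => ⋃ w ∈ X j, μ w) := by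
  have hne' : ∀ K : Set W, K.Nonempty → (⋃ w ∈ K, μ w).Nonempty := by
    rintro K ⟨w, hw⟩
    obtain ⟨x, hx⟩ := hne w
    exact ⟨x, Set.mem_biUnion hw hx⟩
  have hd : ∀ K L : Set W, Disjoint K L → Disjoint (⋃ w ∈ K, μ w) (⋃ w ∈ L, μ w) := by
    intro K L hKL
    simp only [Set.disjoint_iUnion_left, Set.disjoint_iUnion_right]
    intro a ha b hb
    exact hdisj fun e => Set.disjoint_left.1 hKL hb (e ▸ ha)
  refine ⟨fun i => hne' _ (h.nonemptyT i), fun i => hne' _ (h.nonemptyX i),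
    fun i => (h.connT i).biUnion hconn hadj, fun i => (h.connX i).biUnion hconn hadj,
    fun i j hij => hd _ _ (h.disjT hij), fun i j hij => hd _ _ (h.disjX hij),
    fun i j => hd _ _ (h.disj i j), fun i j => ?_⟩
  obtain ⟨a, ha, b, hb, hab⟩ := h.adj i j
  obtain ⟨u, hu, v, hv, huv⟩ := hadj hab
  exact ⟨u, Set.mem_biUnion ha hu, v, Set.mem_biUnion hb hv, huv⟩

lemma HasK.of_model {t m : ℕ} {G' : SimpleGraph W} {G : SimpleGraph V} {μ : W → Set V}
    (hne : ∀ w, (μ w).Nonempty) (hconn : ∀ w, ReachConn G (μ w))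
    (hdisj : Pairwise fun a b => Disjoint (μ a) (μ b))
    (hadj : ∀ ⦃a b⦄, G'.Adj a b → ∃ u ∈ μ a, ∃ v ∈ μ b, G.Adj u v)
    (h : HasK t m G') : HasK t m G := by
  obtain ⟨T, X, h⟩ := h
  exact ⟨_, _, h.biUnion hne hconn hdisj hadj⟩

lemma HasK.of_injective {t m : ℕ} {G' : SimpleGraph W} {G : SimpleGraph V} (f : G' →g G)
    (hf : Function.Injective f) (h : HasK t m G') : HasK t m G :=
  h.of_model (μ := fun w => {f w}) (fun w => Set.singleton_nonempty _)
    (fun w => reachConn_singleton _ _) (fun a b hab => by simpa using fun e => hab (hf e.symm).symm)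
    (fun a b hab => ⟨f a, rfl, f b, rfl, f.map_adj hab⟩)

lemma HasK.mono {t m : ℕ} {G H : SimpleGraph V} (hGH : G ≤ H) (h : HasK t m G) : HasK t m H :=
  h.of_injective (.ofLE hGH) Function.injective_id

lemma HasK.of_induce {t m : ℕ} {G : SimpleGraph V} {s : Set V} (h : HasK t m (G.induce s)) :
    HasK t m G :=
  h.of_injective (Embedding.induce s).toHom Subtype.val_injective

/-- Discard branch sets. -/
lemma HasK.of_le {t m m' : ℕ} {G : SimpleGraph V} (hm : m ≤ m') (h : HasK t m' G) :
    HasK t m G := by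
  obtain ⟨T, X, h⟩ := h
  refine ⟨T, fun j => X (Fin.castLE hm j), h.nonemptyT, fun j => h.nonemptyX _, h.connT,
    fun j => h.connX _, h.disjT, fun i j hij => h.disjX ?_, fun i j => h.disj _ _,
    fun i j => h.adj _ _⟩
  exact fun e => hij (Fin.castLE_injective hm e)

end Tools

section Density

universe u

variable {V : Type*} {W : Type u}

/-- The graph obtained from `G` by turning the sets `μ w` into vertices. -/
def modelGraph (G : SimpleGraph V) (μ : W → Set V) : SimpleGraph W where
  Adj a b := a ≠ b ∧ ∃ x ∈ μ a, ∃ y ∈ μ b, G.Adj x y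
  symm := ⟨fun _ _ ⟨h, x, hx, y, hy, hxy⟩ => ⟨h.symm, y, hy, x, hx, hxy.symm⟩⟩
  loopless := ⟨fun _ h => h.1 rfl⟩

lemma HasK.of_modelGraph {t m : ℕ} {G : SimpleGraph V} {μ : W → Set V}
    (hne : ∀ w, (μ w).Nonempty) (hconn : ∀ w, ReachConn G (μ w))
    (hdisj : Pairwise fun a b => Disjoint (μ a) (μ b))
    (h : HasK t m (modelGraph G μ)) : HasK t m G :=
  HasK.of_model (G' := modelGraph G μ) hne hconn hdisj (fun _ _ hab => hab.2) h

/-- The set of ordered pairs of adjacent vertices. -/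
def arcs (H : SimpleGraph W) : Set (W × W) := {p | H.Adj p.1 p.2}

lemma arcs_ncard [Fintype W] (H : SimpleGraph W) :
    (arcs H).ncard = ∑ v, (H.neighborSet v).ncard := by
  let e : arcs H ≃ Σ v, H.neighborSet v :=
    ⟨fun p => ⟨p.1.1, ⟨p.1.2, p.2⟩⟩, fun q => ⟨(q.1, q.2.1), q.2.2⟩, fun _ => rfl, fun _ => rfl⟩
  rw [← Nat.card_coe_set_eq, Nat.card_congr e, Nat.card_sigma]
  simp [Nat.card_coe_set_eq]

lemma mul_card_le_arcs [Finite W] (H : SimpleGraph W) (d : ℕ)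
    (h : ∀ v, d ≤ (H.neighborSet v).ncard) : d * Nat.card W ≤ (arcs H).ncard := by
  have := Fintype.ofFinite W
  rw [arcs_ncard, Nat.card_eq_fintype_card, mul_comm, ← smul_eq_mul, ← Finset.card_univ]
  exact Finset.card_nsmul_le_sum _ _ _ fun v _ => h v

lemma arcs_le_mul_pred [Finite W] (H : SimpleGraph W) :
    (arcs H).ncard ≤ Nat.card W * (Nat.card W - 1) := by
  have := Fintype.ofFinite W
  rw [arcs_ncard, Nat.card_eq_fintype_card, ← smul_eq_mul, ← Finset.card_univ]
  refine Finset.sum_le_card_nsmul _ _ _ fun v _ => ?_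
  have h1 : (H.neighborSet v).ncard ≤ ({v}ᶜ : Set W).ncard :=
    Set.ncard_le_ncard fun x hx => by simpa using (H.ne_of_adj hx).symm
  rwa [Set.ncard_compl, Set.ncard_singleton, Nat.card_eq_fintype_card, ← Finset.card_univ] at h1

/-- The bags of the contraction of `v` into `u`. -/
def contractBag (u v : W) (w : {x // x ≠ v}) : Set W := {x | x = w ∨ (x = v ∧ (w : W) = u)}

lemma HasK.of_contract {t m : ℕ} {H : SimpleGraph W} {u v : W} (huv : H.Adj u v)
    (h : HasK t m (modelGraph H (contractBag u v))) : HasK t m H := by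
  refine HasK.of_modelGraph (μ := contractBag u v) (fun w => ⟨w, Or.inl rfl⟩) ?_ ?_ h
  · rintro w x hx y hy
    have hadj : (w : W) = u → (restrictTo H (contractBag u v w)).Adj w v := fun e =>
      ⟨by rwa [e], Or.inl rfl, Or.inr ⟨rfl, e⟩⟩
    rcases hx with rfl | ⟨rfl, hx⟩ <;> rcases hy with rfl | ⟨rfl, hy⟩
    · exact Reachable.refl _
    · exact (hadj hy).reachable
    · exact (hadj hx).symm.reachable
    · exact Reachable.refl _
  · intro a b hab
    rw [Set.disjoint_left]
    rintro x (rfl | ⟨rfl, ha⟩) (hb | ⟨hb, hb'⟩)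
    · exact hab (Subtype.ext hb)
    · exact a.2 hb
    · exact b.2 hb.symm
    · exact hab (Subtype.ext (ha.trans hb'.symm))

lemma arcs_contract [Finite W] {H : SimpleGraph W} {u v : W} (huv : H.Adj u v) :
    (arcs H).ncard ≤ (arcs (modelGraph H (contractBag u v))).ncard +
      (2 + 2 * (H.neighborSet u ∩ H.neighborSet v).ncard) := by
  classical
  set N := H.neighborSet u ∩ H.neighborSet v with hN
  set E : Set (W × W) := {(u, v), (v, u)} ∪ ((fun x => (v, x)) '' N ∪ (fun x => (x, v)) '' N)
    with hE
  have hEcard : E.ncard ≤ 2 + 2 * N.ncard := by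
    refine (Set.ncard_union_le _ _).trans ?_
    have h1 : ({(u, v), (v, u)} : Set (W × W)).ncard ≤ 2 := by
      refine (Set.ncard_insert_le _ _).trans ?_
      simp
    have h2 := Set.ncard_union_le ((fun x => (v, x)) '' N) ((fun x => (x, v)) '' N)
    have h3 : ((fun x => (v, x)) '' N).ncard ≤ N.ncard := Set.ncard_image_le (Set.toFinite _)
    have h4 : ((fun x => (x, v)) '' N).ncard ≤ N.ncard := Set.ncard_image_le (Set.toFinite _)
    omega
  let π : W → {x // x ≠ v} := fun x => if h : x = v then ⟨u, huv.ne⟩ else ⟨x, h⟩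
  have hπv : π v = ⟨u, huv.ne⟩ := by simp [π]
  have hπ : ∀ x, x ≠ v → (π x : W) = x := fun x hx => by simp [π, hx]
  have hmem : ∀ x, x ∈ contractBag u v (π x) := by
    intro x
    by_cases h : x = v
    · subst h; rw [hπv]; exact Or.inr ⟨rfl, rfl⟩
    · exact Or.inl (hπ x h).symm
  have hπeq : ∀ x y, π x = π y → x = y ∨ (x = u ∧ y = v) ∨ (x = v ∧ y = u) := by
    intro x y hxy
    by_cases hx : x = v <;> by_cases hy : y = v
    · exact Or.inl (hx.trans hy.symm)
    · have := congrArg Subtype.val hxy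
      rw [hx, hπv, hπ y hy] at this
      exact Or.inr (Or.inr ⟨hx, this.symm⟩)
    · have := congrArg Subtype.val hxy
      rw [hy, hπv, hπ x hx] at this
      exact Or.inr (Or.inl ⟨this, hy⟩)
    · have := congrArg Subtype.val hxy
      rw [hπ x hx, hπ y hy] at this
      exact Or.inl this
  have hdiff : (arcs H \ E).ncard ≤ (arcs (modelGraph H (contractBag u v))).ncard := by
    refine Set.ncard_le_ncard_of_injOn (fun p => (π p.1, π p.2)) ?_ ?_ (Set.toFinite _)
    · rintro ⟨a, b⟩ ⟨hab, hnE⟩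
      have hab' : H.Adj a b := hab
      refine ⟨fun h => ?_, a, hmem a, b, hmem b, hab⟩
      rcases hπeq a b h with h | ⟨rfl, rfl⟩ | ⟨rfl, rfl⟩
      · exact hab'.ne h
      · exact hnE (by simp [hE])
      · exact hnE (by simp [hE])
    · rintro ⟨a, b⟩ ⟨hab, hnE⟩ ⟨a', b'⟩ ⟨hab', hnE'⟩ heq
      have hab1 : H.Adj a b := hab
      have hab2 : H.Adj a' b' := hab'
      simp only [Prod.mk.injEq] at heq
      simp only [hE, hN, Set.mem_union, Set.mem_insert_iff, Set.mem_singleton_iff, Prod.mk.injEq,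
        Set.mem_image, Set.mem_inter_iff, mem_neighborSet, not_or, not_exists, not_and] at hnE hnE'
      have e1 := hπeq _ _ heq.1
      have e2 := hπeq _ _ heq.2
      have h1 := hab1.symm
      have h2 := hab2.symm
      grind
  have := Set.ncard_le_ncard_sdiff_add_ncard (arcs H) E (Set.toFinite _)
  omega

lemma hasK_succ_of_neighborSet {t m : ℕ} {H : SimpleGraph W} (v : W)
    (h : HasK t m (H.induce (H.neighborSet v))) : HasK (t + 1) m H := by
  obtain ⟨T, X, h⟩ := h
  have h' := h.biUnion (G := H) (μ := fun w : H.neighborSet v => {w.1})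
    (fun w => Set.singleton_nonempty _) (fun w => reachConn_singleton _ _)
    (fun a b hab => by simpa using fun e => hab (Subtype.ext e))
    (fun a b hab => ⟨a, rfl, b, rfl, hab⟩)
  have hsub : ∀ K : Set (H.neighborSet v), (⋃ w ∈ K, ({w.1} : Set W)) ⊆ H.neighborSet v := by
    intro K x hx
    simp only [Set.mem_iUnion, Set.mem_singleton_iff] at hx
    obtain ⟨w, _, rfl⟩ := hx
    exact w.2
  have hd : ∀ K : Set (H.neighborSet v), Disjoint {v} (⋃ w ∈ K, ({w.1} : Set W)) := by
    intro K
    rw [Set.disjoint_singleton_left]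
    exact fun hv => H.loopless.1 v (hsub K hv)
  refine ⟨Fin.cons {v} fun i => ⋃ w ∈ T i, {w.1}, fun j => ⋃ w ∈ X j, {w.1}, ?_, h'.nonemptyX,
    ?_, h'.connX, ?_, h'.disjX, ?_, ?_⟩
  · exact Fin.cases (Set.singleton_nonempty _) h'.nonemptyT
  · exact Fin.cases (reachConn_singleton _ _) h'.connT
  · intro i j
    refine Fin.cases ?_ (fun i => ?_) i <;> refine Fin.cases ?_ (fun j => ?_) j
    · intro h; exact absurd rfl h
    · intro _; exact hd _
    · intro _; exact (hd _).symm
    · intro hij; exact h'.disjT fun e : i = j => hij (by rw [e])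
  · exact Fin.cases (fun j => hd _) h'.disj
  · refine Fin.cases (fun j => ?_) h'.adj
    obtain ⟨x, hx⟩ := h'.nonemptyX j
    exact ⟨v, rfl, x, hx, hsub _ hx⟩

/-- Mader's bound: a graph of large average degree has a `K_{t,m}` minor. -/
theorem hasK_of_arcs (m : ℕ) (hm : 1 ≤ m) : ∀ (t : ℕ) {W : Type u} [Finite W]
    (H : SimpleGraph W), 1 ≤ Nat.card W → 2 ^ t * m * Nat.card W ≤ (arcs H).ncard →
    HasK t m H := by
  intro t
  induction t with
  | zero =>
    intro W _ H hW h
    have h1 := h.trans (arcs_le_mul_pred H)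
    have h2 : m ≤ Nat.card W - 1 := by
      rw [pow_zero, one_mul, mul_comm] at h1
      exact Nat.le_of_mul_le_mul_left h1 hW
    have := Fintype.ofFinite W
    rw [Nat.card_eq_fintype_card] at h2
    obtain ⟨f⟩ : Nonempty (Fin m ↪ W) :=
      Function.Embedding.nonempty_of_card_le (by rw [Fintype.card_fin]; omega)
    refine ⟨Fin.elim0, fun j => {f j}, fun i => i.elim0, fun j => Set.singleton_nonempty _,
      fun i => i.elim0, fun j => reachConn_singleton _ _, fun i => i.elim0, fun i j hij => ?_,
      fun i => i.elim0, fun i => i.elim0⟩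
    simpa using fun e => hij e
  | succ t iht =>
    have main : ∀ (n : ℕ) {W : Type u} [Finite W] (H : SimpleGraph W), Nat.card W = n →
        1 ≤ n → 2 ^ (t + 1) * m * n ≤ (arcs H).ncard → HasK (t + 1) m H := by
      intro n
      induction n with
      | zero => intro W _ H _ h; omega
      | succ n ihn =>
        intro W _ H hW _ h
        obtain ⟨d, hd⟩ : ∃ d, d = 2 ^ t * m := ⟨_, rfl⟩
        have hdpos : 1 ≤ d := by rw [hd]; exact Nat.mul_pos (by positivity) hm
        have hd' : 2 ^ (t + 1) * m = 2 * d := by rw [hd]; ring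
        rw [hd'] at h
        obtain ⟨⟨u, w⟩, huw⟩ : (arcs H).Nonempty := by
          rw [← Set.ncard_pos]
          exact lt_of_lt_of_le (by positivity) h
        have huw : H.Adj u w := huw
        by_cases hc : ∃ u v, H.Adj u v ∧ (H.neighborSet u ∩ H.neighborSet v).ncard + 1 ≤ d
        · obtain ⟨u, v, huv, hle⟩ := hc
          have := Fintype.ofFinite W
          have hcard : Nat.card {x // x ≠ v} = n := by
            classical
            rw [Nat.card_eq_fintype_card] at hW ⊢
            rw [Fintype.card_subtype_compl, hW]; simp
          have h1 := arcs_contract huv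
          refine HasK.of_contract huv (ihn _ hcard ?_ ?_)
          · have : 0 < Nat.card {x // x ≠ v} := Nat.card_pos_iff.2 ⟨⟨⟨u, huv.ne⟩⟩, inferInstance⟩
            omega
          · rw [hd']
            have : 2 * d * (n + 1) = 2 * d * n + 2 * d := by ring
            omega
        · push Not at hc
          refine hasK_succ_of_neighborSet u (iht _ ?_ ?_)
          · exact Nat.card_pos_iff.2 ⟨⟨⟨w, huw⟩⟩, inferInstance⟩
          · rw [← hd]
            refine mul_card_le_arcs _ _ fun x => ?_
            have h2 := hc u x x.2
            have h3 : (H.neighborSet u ∩ H.neighborSet x).ncard ≤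
                ((H.induce (H.neighborSet u)).neighborSet x).ncard := by
              rw [← Set.ncard_image_of_injective _ Subtype.val_injective]
              refine Set.ncard_le_ncard ?_ (Set.toFinite _)
              rintro y ⟨hy1, hy2⟩
              exact ⟨⟨y, hy1⟩, hy2, rfl⟩
            omega
    intro W _ H hW h
    exact main _ H rfl hW h

end Density

section LightEdges

universe u

variable {V : Type u}

lemma ncard_le_mul_ncard {α β : Type*} {s : Set α} {t : Set β} (hs : s.Finite) (ht : t.Finite)
    (f : α → β) (hf : ∀ a ∈ s, f a ∈ t) (n : ℕ) (hn : ∀ b ∈ t, {a ∈ s | f a = b}.ncard ≤ n) :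
    s.ncard ≤ n * t.ncard := by
  classical
  lift s to Finset α using hs
  lift t to Finset β using ht
  rw [Set.ncard_coe_finset, Set.ncard_coe_finset]
  refine Finset.card_le_mul_card_image_of_maps_to hf n fun b hb => ?_
  have := hn b hb
  have e : {a | a ∈ (s : Set α) ∧ f a = b} = ((s.filter fun a => f a = b : Finset α) : Set α) := by
    ext; simp
  rwa [e, Set.ncard_coe_finset] at this

lemma hasK_of_common {t m : ℕ} {G : SimpleGraph V} {S R : Set V} (hS : t ≤ S.ncard)
    (hR : m ≤ R.ncard) (hSf : S.Finite) (hRf : R.Finite) (h : ∀ s ∈ S, ∀ r ∈ R, G.Adj s r) :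
    HasK t m G := by
  have key : ∀ (k : ℕ) (A : Set V), A.Finite → k ≤ A.ncard →
      ∃ f : Fin k → V, Function.Injective f ∧ ∀ i, f i ∈ A := by
    intro k A hA hk
    have := hA.fintype
    obtain ⟨f⟩ : Nonempty (Fin k ↪ A) := Function.Embedding.nonempty_of_card_le (by
      rwa [Fintype.card_fin, ← Nat.card_eq_fintype_card, Nat.card_coe_set_eq])
    exact ⟨fun i => f i, Subtype.val_injective.comp f.injective, fun i => (f i).2⟩
  obtain ⟨f, hf, hfS⟩ := key t S hSf hS
  obtain ⟨g, hg, hgR⟩ := key m R hRf hR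
  refine ⟨fun i => {f i}, fun j => {g j}, fun i => Set.singleton_nonempty _,
    fun i => Set.singleton_nonempty _, fun i => reachConn_singleton _ _,
    fun i => reachConn_singleton _ _, fun i j hij => ?_, fun i j hij => ?_, fun i j => ?_,
    fun i j => ⟨_, rfl, _, rfl, h _ (hfS i) _ (hgR j)⟩⟩
  · simpa using fun e => hij (hf e)
  · simpa using fun e => hij (hg e)
  · simpa using (h _ (hfS i) _ (hgR j)).ne

lemma exists_degree_lt {t m : ℕ} (hm : 1 ≤ m) {W : Type u} [Finite W] [Nonempty W]
    {K : SimpleGraph W} (hK : ¬ HasK t m K) :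
    ∃ v, (K.neighborSet v).ncard < 2 ^ t * m := by
  by_contra! h
  exact hK (hasK_of_arcs m hm t K Nat.card_pos (mul_card_le_arcs _ _ h))

/-- A bound on the number of cliques in a graph without a `K_{t,m}` minor. -/
lemma ncard_cliques_le {t m : ℕ} (hm : 1 ≤ m) {W : Type u} {β : Type*} [Finite W] [Finite β]
    {K : SimpleGraph W} (hK : ¬ HasK t m K) (R : Set β) (N : β → Set W)
    (hne : ∀ b ∈ R, (N b).Nonempty)
    (hclique : ∀ b ∈ R, ∀ x ∈ N b, ∀ y ∈ N b, x ≠ y → K.Adj x y)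
    (hmult : ∀ S : Set W, {b ∈ R | N b = S}.ncard ≤ m) (n : ℕ) :
    ∀ X : Set W, X.ncard = n → {b ∈ R | N b ⊆ X}.ncard ≤ m * 2 ^ (2 ^ t * m) * n := by
  induction n with
  | zero =>
    intro X hX
    rw [Set.ncard_eq_zero] at hX
    subst hX
    have : {b ∈ R | N b ⊆ ∅} = ∅ := by
      ext b
      simp only [Set.subset_empty_iff, Set.mem_ofPred_eq, Set.mem_empty_iff_false, iff_false]
      exact fun h => (hne b h.1).ne_empty h.2
    rw [this]; simp
  | succ n ih =>
    intro X hX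
    have hXne : X.Nonempty := by rw [← Set.ncard_pos]; omega
    have := hXne.to_subtype
    obtain ⟨v, hv⟩ := exists_degree_lt hm (K := K.induce X) fun h => hK h.of_induce
    set Y : Set W := insert (v : W) (Subtype.val '' (K.induce X).neighborSet v) with hY
    have hYcard : Y.ncard ≤ 2 ^ t * m := by
      refine (Set.ncard_insert_le _ _).trans ?_
      rw [Set.ncard_image_of_injective _ Subtype.val_injective]
      omega
    have hX' : (X \ {v.1}).ncard = n := by
      rw [Set.ncard_sdiff_singleton_of_mem v.2, hX]; simp
    have hsub : {b ∈ R | N b ⊆ X} ⊆ {b ∈ R | N b ⊆ X \ {v.1}} ∪ {b ∈ R | N b ⊆ Y} := by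
      rintro b ⟨hb, hbX⟩
      by_cases hvb : v.1 ∈ N b
      · refine Or.inr ⟨hb, fun x hx => ?_⟩
        by_cases hxv : x = v
        · exact Or.inl hxv
        · exact Or.inr ⟨⟨x, hbX hx⟩, hclique b hb v hvb x hx (Ne.symm hxv), rfl⟩
      · refine Or.inl ⟨hb, fun x hx => ⟨hbX hx, ?_⟩⟩
        rintro rfl
        exact hvb hx
    have h1 : {b ∈ R | N b ⊆ Y}.ncard ≤ m * 2 ^ (2 ^ t * m) := by
      refine (ncard_le_mul_ncard (t := 𝒫 Y) (Set.toFinite _) (Set.toFinite _) N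
        (fun b hb => hb.2) m fun S _ => ?_).trans ?_
      · refine le_trans (Set.ncard_le_ncard ?_ (Set.toFinite _)) (hmult S)
        exact fun b hb => ⟨hb.1.1, hb.2⟩
      · rw [Set.ncard_powerset _ (Set.toFinite _)]
        exact Nat.mul_le_mul_left _ (Nat.pow_le_pow_right (by norm_num) hYcard)
    have h2 := ih _ hX'
    have h3 := Set.ncard_le_ncard hsub (Set.toFinite _)
    have h4 := Set.ncard_union_le {b ∈ R | N b ⊆ X \ {v.1}} {b ∈ R | N b ⊆ Y}
    rw [mul_add, mul_one]
    omega

/-- The bags of the stars centred at `A` given by sending each `x ∈ B` to `g x`. -/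
def starBag (A B : Set V) (g : V → V) (a : A) : Set V := {x | x = a ∨ (x ∈ B ∧ g x = a)}

lemma HasK.of_starBag {t m : ℕ} {G : SimpleGraph V} {A B : Set V} {g : V → V}
    (hAB : Disjoint A B) (hg : ∀ b ∈ B, G.Adj b (g b))
    (h : HasK t m (modelGraph G (starBag A B g))) : HasK t m G := by
  refine HasK.of_modelGraph (μ := starBag A B g) (fun w => ⟨w, Or.inl rfl⟩) ?_ ?_ h
  · rintro w
    have hr : ∀ x ∈ starBag A B g w, (restrictTo G (starBag A B g w)).Reachable w x := by
      rintro x (rfl | ⟨hx, hxw⟩)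
      · exact Reachable.refl _
      · have : (restrictTo G (starBag A B g w)).Adj w x :=
          ⟨by rw [← hxw]; exact (hg x hx).symm, Or.inl rfl, Or.inr ⟨hx, hxw⟩⟩
        exact this.reachable
    exact fun x hx y hy => (hr x hx).symm.trans (hr y hy)
  · intro a b hab
    rw [Set.disjoint_left]
    rintro x (rfl | ⟨hx, ha⟩) (hb | ⟨hb, hbc⟩)
    · exact hab (Subtype.ext hb)
    · exact Set.disjoint_left.1 hAB a.2 hb
    · subst hb
      exact Set.disjoint_left.1 hAB b.2 hx
    · exact hab (Subtype.ext (ha.symm.trans hbc))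

/-- The degree bound for light edges in graphs without a `K_{t,m}` minor. -/
def lightBound (t m : ℕ) : ℕ := 2 ^ t * m * (2 ^ t * m + m * 2 ^ (2 ^ t * m) + 1)

/-- A graph without a `K_{t,m}` minor has a vertex of degree less than `t` or an edge between
two vertices of bounded degree. -/
theorem exists_light_edge {t m : ℕ} (ht : 1 ≤ t) (hm : 1 ≤ m) [Finite V] [Nonempty V]
    {G : SimpleGraph V} (hG : ¬ HasK t m G) :
    (∃ v, (G.neighborSet v).ncard < t) ∨ ∃ u v, G.Adj u v ∧
      (G.neighborSet u).ncard ≤ lightBound t m ∧ (G.neighborSet v).ncard ≤ lightBound t m := by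
  classical
  have := Fintype.ofFinite V
  by_contra! hcon
  obtain ⟨hdeg, hlight⟩ := hcon
  obtain ⟨D, hD⟩ : ∃ D, D = lightBound t m := ⟨_, rfl⟩
  rw [← hD] at hlight
  obtain ⟨A, hA⟩ : ∃ A : Set V, A = {v | D < (G.neighborSet v).ncard} := ⟨_, rfl⟩
  have hNA : ∀ b, b ∉ A → G.neighborSet b ⊆ A := by
    intro b hb x hx
    rw [hA, Set.mem_ofPred_eq, not_lt] at hb
    rw [hA]
    exact hlight b x hx hb
  have hAne : A.Nonempty := by
    obtain ⟨v⟩ := ‹Nonempty V›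
    by_cases hv : v ∈ A
    · exact ⟨v, hv⟩
    · have : (G.neighborSet v).Nonempty := by
        rw [← Set.ncard_pos]; exact lt_of_lt_of_le ht (hdeg v)
      exact this.mono (hNA v hv)
  have hAne' := hAne.to_subtype
  have hApos : 1 ≤ A.ncard := (Set.ncard_pos (Set.toFinite _)).2 hAne
  -- a maximal partial contraction
  let P : Set V → (V → V) → Prop := fun B g => Disjoint A B ∧ (∀ b ∈ B, G.Adj b (g b)) ∧
    B.ncard ≤ (arcs (modelGraph G (starBag A B g))).ncard
  obtain ⟨B, g, hP, hmax⟩ : ∃ B g, P B g ∧ ∀ B' g', P B' g' → B'.ncard ≤ B.ncard := by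
    let Q : ℕ → Prop := fun n => ∃ B g, P B g ∧ B.ncard = n
    have hQ0 : Q 0 := ⟨∅, id, ⟨by simp, by simp, by simp⟩, by simp⟩
    obtain ⟨B, g, hP, hB⟩ := Nat.findGreatest_spec (P := Q) (Nat.zero_le (Nat.card V)) hQ0
    refine ⟨B, g, hP, fun B' g' h' => ?_⟩
    rw [hB]
    refine Nat.le_findGreatest ?_ ⟨B', g', h', rfl⟩
    rw [← Set.ncard_univ]
    exact Set.ncard_le_ncard (Set.subset_univ _)
  obtain ⟨hAB, hg, hBle⟩ := hP
  set K := modelGraph G (starBag A B g) with hKdef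
  have hK : ¬ HasK t m K := fun h => hG (h.of_starBag hAB hg)
  have hKarcs : (arcs K).ncard < 2 ^ t * m * A.ncard := by
    by_contra! h
    refine hK (hasK_of_arcs m hm t K ?_ ?_) <;> rwa [Nat.card_coe_set_eq]
  have hclique : ∀ b, b ∉ A → b ∉ B → ∀ x y : A, G.Adj b x → G.Adj b y → x ≠ y → K.Adj x y := by
    intro b hbA hbB x y hx hy hxy
    by_contra hnadj
    have hP' : P (insert b B) (Function.update g b x) := by
      refine ⟨?_, ?_, ?_⟩
      · rw [Set.disjoint_insert_right]; exact ⟨hbA, hAB⟩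
      · rintro c (rfl | hc)
        · simpa using hx
        · rw [Function.update_of_ne (by rintro rfl; exact hbB hc)]
          exact hg c hc
      · rw [Set.ncard_insert_of_notMem hbB]
        refine Nat.succ_le_of_lt (lt_of_le_of_lt hBle (Set.ncard_lt_ncard ?_ (Set.toFinite _)))
        have hbag : ∀ a, starBag A B g a ⊆
            starBag A (insert b B) (Function.update g b x) a := by
          rintro a z (rfl | ⟨hz, hza⟩)
          · exact Or.inl rfl
          · refine Or.inr ⟨Or.inr hz, ?_⟩
            rw [Function.update_of_ne (by rintro rfl; exact hbB hz)]
            exact hza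
        rw [Set.ssubset_iff_of_subset]
        · refine ⟨(x, y), ⟨hxy, b, Or.inr ⟨Or.inl rfl, by simp⟩, y, Or.inl rfl, hy⟩, hnadj⟩
        · rintro ⟨a, a'⟩ ⟨hne, u, hu, v, hv, huv⟩
          exact ⟨hne, u, hbag _ hu, v, hbag _ hv, huv⟩
    have := hmax _ _ hP'
    rw [Set.ncard_insert_of_notMem hbB] at this
    omega
  -- counting the remaining low-degree vertices
  have hrest : (Aᶜ \ B).ncard ≤ m * 2 ^ (2 ^ t * m) * A.ncard := by
    have hval : ∀ b, b ∉ A → Subtype.val '' {x : A | G.Adj b x} = G.neighborSet b := by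
      intro b hb
      ext x
      constructor
      · rintro ⟨x, hx, rfl⟩; exact hx
      · exact fun hx => ⟨⟨x, hNA b hb hx⟩, hx, rfl⟩
    have := ncard_cliques_le hm hK (Aᶜ \ B) (fun b => {x : A | G.Adj b x}) ?_ ?_ ?_ A.ncard
      Set.univ (by rw [Set.ncard_univ, Nat.card_coe_set_eq])
    · refine le_trans (Set.ncard_le_ncard ?_ (Set.toFinite _)) this
      exact fun b hb => ⟨hb, Set.subset_univ _⟩
    · intro b hb
      have h1 := hdeg b
      rw [← hval b hb.1] at h1
      have : (Subtype.val '' {x : A | G.Adj b x}).Nonempty := by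
        rw [← Set.ncard_pos (Set.toFinite _)]; omega
      exact this.of_image
    · exact fun b hb x hx y hy hxy => hclique b hb.1 hb.2 x y hx hy hxy
    · intro S
      by_contra! hlt
      obtain ⟨b, hb, hbS⟩ : {b ∈ Aᶜ \ B | {x : A | G.Adj b x} = S}.Nonempty := by
        rw [← Set.ncard_pos (Set.toFinite _)]; omega
      refine hG (hasK_of_common (S := Subtype.val '' S)
        (R := {b ∈ Aᶜ \ B | {x : A | G.Adj b x} = S}) ?_ hlt.le (Set.toFinite _)
        (Set.toFinite _) ?_)
      · rw [← hbS, hval b hb.1]; exact hdeg b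
      · rintro _ ⟨s, hs, rfl⟩ r ⟨_, rfl⟩
        exact hs.symm
  have hV : Nat.card V = A.ncard + Aᶜ.ncard := by
    rw [Set.ncard_add_ncard_compl]
  have hBc : Aᶜ.ncard ≤ (Aᶜ \ B).ncard + B.ncard :=
    Set.ncard_le_ncard_sdiff_add_ncard _ _ (Set.toFinite _)
  have hGarcs : (arcs G).ncard < 2 ^ t * m * Nat.card V := by
    by_contra! h
    exact hG (hasK_of_arcs m hm t G Nat.card_pos h)
  have hlow : (D + 1) * A.ncard ≤ (arcs G).ncard := by
    rw [arcs_ncard, mul_comm, Set.ncard_eq_toFinset_card', ← smul_eq_mul]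
    refine (Finset.card_nsmul_le_sum A.toFinset (fun v => (G.neighborSet v).ncard) _ ?_).trans
      (Finset.sum_le_sum_of_subset (Finset.subset_univ _))
    intro v hv
    rw [Set.mem_toFinset, hA] at hv
    exact hv
  rw [hD, lightBound] at hlow
  generalize 2 ^ t * m = d at *
  generalize m * 2 ^ d = q at *
  have h1 : Nat.card V ≤ (d + q + 1) * A.ncard := by
    rw [hV]
    have : (d + q + 1) * A.ncard = d * A.ncard + q * A.ncard + A.ncard := by ring
    omega
  have h2 : d * Nat.card V ≤ d * (d + q + 1) * A.ncard := by
    rw [mul_assoc]; exact Nat.mul_le_mul_left _ h1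
  have h3 : (d * (d + q + 1) + 1) * A.ncard = d * (d + q + 1) * A.ncard + A.ncard := by ring
  omega

end LightEdges

section Decomposition

universe u

variable {V : Type u}

lemma exists_decomposition_aux {t m : ℕ} (ht : 1 ≤ t) (hm : 1 ≤ m) [Finite V] (n : ℕ) :
    ∀ (S : Set V) (H : SimpleGraph V), S.ncard + (arcs H).ncard = n → ¬ HasK t m H →
    ∃ L ≤ H, (∀ a b, L.Adj a b → a ∈ S ∧ b ∈ S) ∧
      (∀ v, (L.neighborSet v).ncard ≤ lightBound t m) ∧
      ∀ T ⊆ S, T.Nonempty → ∃ v ∈ T, {x ∈ T | H.Adj v x ∧ ¬ L.Adj v x}.ncard < t := by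
  induction n using Nat.strong_induction_on with
  | _ n ih =>
  intro S H hn hH
  rcases S.eq_empty_or_nonempty with rfl | hS
  · refine ⟨⊥, bot_le, by simp, fun v => ?_, fun T hT hT' => ?_⟩
    · have : (⊥ : SimpleGraph V).neighborSet v = ∅ := by ext; simp
      rw [this]; simp
    · obtain ⟨x, hx⟩ := hT'
      exact absurd (hT hx) (Set.notMem_empty x)
  have := hS.to_subtype
  have hdeg : ∀ v : S, ((H.induce S).neighborSet v).ncard = {x ∈ S | H.Adj v x}.ncard := by
    intro v
    rw [← Set.ncard_image_of_injective _ Subtype.val_injective]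
    congr 1
    ext x
    constructor
    · rintro ⟨x, hx, rfl⟩; exact ⟨x.2, hx⟩
    · rintro ⟨hx, hx'⟩; exact ⟨⟨x, hx⟩, hx', rfl⟩
  rcases exists_light_edge ht hm (G := H.induce S) fun h => hH h.of_induce with
    ⟨v, hv⟩ | ⟨u, v, huv, hu, hv⟩
  · rw [hdeg] at hv
    have hcard : (S \ {v.1}).ncard < S.ncard := Set.ncard_sdiff_singleton_lt_of_mem v.2
    obtain ⟨L, hLH, hLS, hLdeg, hL⟩ := ih _ (by omega) (S \ {v.1}) H rfl hH
    refine ⟨L, hLH, fun a b hab => ⟨(hLS a b hab).1.1, (hLS a b hab).2.1⟩, hLdeg,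
      fun T hT hTne => ?_⟩
    by_cases hvT : v.1 ∈ T
    · refine ⟨v, hvT, lt_of_le_of_lt (Set.ncard_le_ncard ?_ (Set.toFinite _)) hv⟩
      exact fun x hx => ⟨hT hx.1, hx.2.1⟩
    · exact hL T (fun x hx => ⟨hT hx, fun e => hvT (by rw [← Set.mem_singleton_iff.1 e]; exact hx)⟩)
        hTne
  · rw [hdeg] at hu hv
    have huv : H.Adj u v := huv
    have hne : u.1 ≠ v.1 := huv.ne
    obtain ⟨H', hH'⟩ : ∃ H', H' = H.deleteEdges {s(u.1, v.1)} := ⟨_, rfl⟩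
    have hadj : ∀ a b, H'.Adj a b ↔
        H.Adj a b ∧ ¬ ((a = u.1 ∧ b = v.1) ∨ (a = v.1 ∧ b = u.1)) := by
      intro a b
      rw [hH', deleteEdges_adj, Set.mem_singleton_iff, Sym2.eq_iff]
    have hle : H' ≤ H := fun a b h => ((hadj a b).1 h).1
    have hcard : (arcs H').ncard < (arcs H).ncard := by
      refine Set.ncard_lt_ncard ((Set.ssubset_iff_of_subset fun p hp => hle hp).2
        ⟨(u.1, v.1), huv, fun h => ?_⟩) (Set.toFinite _)
      exact ((hadj _ _).1 h).2 (Or.inl ⟨rfl, rfl⟩)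
    obtain ⟨L, hLH, hLS, hLdeg, hL⟩ := ih _ (by omega) S H' rfl fun h => hH (h.mono hle)
    have hLadj : ∀ a b, (L ⊔ edge u.1 v.1).Adj a b ↔
        L.Adj a b ∨ ((a = u.1 ∧ b = v.1) ∨ (a = v.1 ∧ b = u.1)) := by
      intro a b
      rw [sup_adj, edge_adj]
      constructor
      · rintro (h | h)
        · exact Or.inl h
        · exact Or.inr h.1
      · rintro (h | h)
        · exact Or.inl h
        · refine Or.inr ⟨h, ?_⟩
          rcases h with ⟨rfl, rfl⟩ | ⟨rfl, rfl⟩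
          · exact hne
          · exact hne.symm
    have hLH' : L ⊔ edge u.1 v.1 ≤ H := by
      intro a b h
      rcases (hLadj a b).1 h with h | ⟨rfl, rfl⟩ | ⟨rfl, rfl⟩
      · exact hle (hLH h)
      · exact huv
      · exact huv.symm
    have hLS' : ∀ a b, (L ⊔ edge u.1 v.1).Adj a b → a ∈ S ∧ b ∈ S := by
      intro a b h
      rcases (hLadj a b).1 h with h | ⟨rfl, rfl⟩ | ⟨rfl, rfl⟩
      · exact hLS a b h
      · exact ⟨u.2, v.2⟩
      · exact ⟨v.2, u.2⟩
    refine ⟨L ⊔ edge u.1 v.1, hLH', hLS', fun w => ?_, fun T hT hTne => ?_⟩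
    · have hsub : (L ⊔ edge u.1 v.1).neighborSet w ⊆ {x ∈ S | H.Adj w x} :=
        fun x hx => ⟨(hLS' _ _ hx).2, hLH' hx⟩
      by_cases hwu : w = u.1
      · subst hwu
        exact (Set.ncard_le_ncard hsub (Set.toFinite _)).trans hu
      by_cases hwv : w = v.1
      · subst hwv
        exact (Set.ncard_le_ncard hsub (Set.toFinite _)).trans hv
      refine (Set.ncard_le_ncard (fun x hx => ?_) (Set.toFinite _)).trans (hLdeg w)
      rcases (hLadj w x).1 hx with h | h | h
      · exact h
      · exact absurd h.1 hwu
      · exact absurd h.1 hwv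
    · obtain ⟨w, hw, hwlt⟩ := hL T hT hTne
      refine ⟨w, hw, lt_of_le_of_lt (Set.ncard_le_ncard ?_ (Set.toFinite _)) hwlt⟩
      rintro x ⟨hxT, hx, hx'⟩
      rw [hLadj, not_or] at hx'
      exact ⟨hxT, (hadj _ _).2 ⟨hx, hx'.2⟩, hx'.1⟩

/-- A graph without a `K_{t,m}` minor is the union of a graph of bounded degree and a
`(t-1)`-degenerate graph. -/
theorem exists_decomposition {t m : ℕ} (ht : 1 ≤ t) (hm : 1 ≤ m) [Finite V] {G : SimpleGraph V}
    (hG : ¬ HasK t m G) : ∃ L ≤ G, (∀ v, (L.neighborSet v).ncard ≤ lightBound t m) ∧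
      ∀ T : Set V, T.Nonempty → ∃ v ∈ T, {x ∈ T | G.Adj v x ∧ ¬ L.Adj v x}.ncard < t := by
  obtain ⟨L, hLG, -, hdeg, hL⟩ := exists_decomposition_aux ht hm _ Set.univ G rfl hG
  exact ⟨L, hLG, hdeg, fun T => hL T (Set.subset_univ T)⟩

end Decomposition

section Metric

variable {V : Type*}

/-- There is a walk of length at most `r` from `x` to `y`. -/
def Near (G : SimpleGraph V) (r : ℕ) (x y : V) : Prop := ∃ p : G.Walk x y, p.length ≤ r

lemma Near.refl (G : SimpleGraph V) (r : ℕ) (x : V) : Near G r x x := ⟨.nil, Nat.zero_le _⟩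

lemma Near.symm {G : SimpleGraph V} {r : ℕ} {x y : V} (h : Near G r x y) : Near G r y x := by
  obtain ⟨p, hp⟩ := h
  exact ⟨p.reverse, by simpa using hp⟩

lemma Near.trans {G : SimpleGraph V} {r s : ℕ} {x y z : V} (h : Near G r x y)
    (h' : Near G s y z) : Near G (r + s) x z := by
  obtain ⟨p, hp⟩ := h
  obtain ⟨q, hq⟩ := h'
  exact ⟨p.append q, by rw [Walk.length_append]; omega⟩

lemma Near.mono {G H : SimpleGraph V} (hGH : G ≤ H) {r s : ℕ} (hrs : r ≤ s) {x y : V}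
    (h : Near G r x y) : Near H s x y := by
  obtain ⟨p, hp⟩ := h
  exact ⟨p.mapLe hGH, by rw [Walk.length_mapLe]; omega⟩

lemma Near.reachable {G : SimpleGraph V} {r : ℕ} {x y : V} (h : Near G r x y) :
    G.Reachable x y := ⟨h.choose⟩

lemma Near.of_adj {G : SimpleGraph V} {x y : V} (h : G.Adj x y) : Near G 1 x y :=
  ⟨h.toWalk, by simp⟩

lemma near_zero {G : SimpleGraph V} {x y : V} : Near G 0 x y ↔ x = y := by
  constructor
  · rintro ⟨p, hp⟩; exact Walk.eq_of_length_eq_zero (Nat.le_zero.1 hp)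
  · rintro rfl; exact Near.refl _ _ _

lemma near_succ {G : SimpleGraph V} {r : ℕ} {x y : V} (h : Near G (r + 1) x y) :
    x = y ∨ ∃ z, G.Adj x z ∧ Near G r z y := by
  obtain ⟨p, hp⟩ := h
  cases p with
  | nil => exact Or.inl rfl
  | cons h p => exact Or.inr ⟨_, h, p, by simpa using hp⟩

/-- Vertices at distance between `1` and `r` are adjacent. -/
def powerGraph (G : SimpleGraph V) (r : ℕ) : SimpleGraph V where
  Adj a b := a ≠ b ∧ Near G r a b
  symm := ⟨fun _ _ h => ⟨h.1.symm, h.2.symm⟩⟩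
  loopless := ⟨fun _ h => h.1 rfl⟩

lemma ncard_near_le [Finite V] {G H : SimpleGraph V} (hHG : H ≤ G) {D : ℕ}
    (hD : ∀ v, (G.neighborSet v).ncard ≤ D) (k : ℕ) (x : V) :
    {y | Near H k x y}.ncard ≤ (D + 1) ^ k := by
  induction k with
  | zero =>
    have : {y | Near H 0 x y} = {x} := by
      ext y; simp [near_zero, eq_comm]
    rw [this]; simp
  | succ k ih =>
    have hpred : ∀ y ∈ {y | Near H (k + 1) x y}, ∃ z, Near H k x z ∧ (y = z ∨ H.Adj z y) := by
      intro y hy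
      rcases near_succ (Near.symm hy) with rfl | ⟨z, hz, hzx⟩
      · exact ⟨_, Near.refl _ _ _, Or.inl rfl⟩
      · exact ⟨z, hzx.symm, Or.inr hz.symm⟩
    choose! f hf hf' using hpred
    refine (ncard_le_mul_ncard (t := {z | Near H k x z}) (Set.toFinite _) (Set.toFinite _) f hf
      (D + 1) fun z _ => ?_).trans ?_
    · have hsub : {y ∈ {y | Near H (k + 1) x y} | f y = z} ⊆ insert z (G.neighborSet z) := by
        rintro y ⟨hy, rfl⟩
        rcases hf' y hy with h | h
        · exact Or.inl h
        · exact Or.inr (hHG h)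
      refine (Set.ncard_le_ncard hsub (Set.toFinite _)).trans ((Set.ncard_insert_le _ _).trans ?_)
      have := hD z
      omega
    · rw [pow_succ, mul_comm]
      exact Nat.mul_le_mul_right _ ih

lemma exists_far {G : SimpleGraph V} [Finite V] {s b : ℕ}
    (hb : ∀ x, {y | Near G s x y}.ncard ≤ b) (m : ℕ) :
    ∀ K : Set V, m * b < K.ncard → ∃ x : Fin m → V, (∀ j, x j ∈ K) ∧
      Pairwise fun i j => ¬ Near G s (x i) (x j) := by
  induction m with
  | zero => exact fun K _ => ⟨Fin.elim0, fun j => j.elim0, fun j => j.elim0⟩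
  | succ m ih =>
    intro K hK
    obtain ⟨y, hy⟩ : K.Nonempty := by rw [← Set.ncard_pos]; omega
    have h1 := Set.ncard_le_ncard_sdiff_add_ncard K {z | Near G s y z} (Set.toFinite _)
    have h2 := hb y
    rw [add_mul, one_mul] at hK
    obtain ⟨x, hxK, hx⟩ := ih (K \ {z | Near G s y z}) (by omega)
    refine ⟨Fin.cons y x, Fin.cases hy fun j => (hxK j).1, fun i j => ?_⟩
    refine Fin.cases ?_ (fun i => ?_) i <;> refine Fin.cases ?_ (fun j => ?_) j
    · exact fun h => absurd rfl h
    · exact fun _ => (hxK j).2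
    · exact fun _ h => (hxK i).2 h.symm
    · exact fun hij => hx fun e : i = j => hij (by rw [e])

/-- A vertex chosen in the component of `x`. -/
noncomputable def root (G : SimpleGraph V) (x : V) : V :=
  Quot.out (G.connectedComponentMk x)

lemma reachable_root (G : SimpleGraph V) (x : V) : G.Reachable (root G x) x :=
  ConnectedComponent.exact (Quot.out_eq (G.connectedComponentMk x))

lemma root_eq {G : SimpleGraph V} {x y : V} (h : G.Reachable x y) : root G x = root G y := by
  have : G.connectedComponentMk x = G.connectedComponentMk y := ConnectedComponent.sound h
  rw [root, root, this]

/-- The distance from the root of the component. -/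
noncomputable def depth (G : SimpleGraph V) (x : V) : ℕ := G.dist (root G x) x

lemma depth_le_succ {G : SimpleGraph V} {a b : V} (h : G.Adj a b) :
    depth G b ≤ depth G a + 1 := by
  obtain ⟨p, hp⟩ := (reachable_root G a).exists_walk_length_eq_dist
  rw [depth, depth, ← root_eq h.reachable, ← hp]
  refine (dist_le (p.append h.toWalk)).trans ?_
  simp

lemma eq_of_depth_eq_zero {G : SimpleGraph V} {x y : V} (h : G.Reachable x y)
    (hx : depth G x = 0) (hy : depth G y = 0) : x = y := by
  rw [depth, (reachable_root G _).dist_eq_zero_iff] at hx hy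
  rw [← hx, ← hy, root_eq h]

lemma depth_le_add {G : SimpleGraph V} {x y : V} {n : ℕ} (h : Near G n x y) :
    depth G y ≤ depth G x + n := by
  induction n generalizing x with
  | zero => rw [near_zero.1 h]; omega
  | succ n ih =>
    rcases near_succ h with rfl | ⟨z, hz, hzy⟩
    · omega
    · have h1 := ih hzy
      have h2 := depth_le_succ hz
      omega

lemma near_root (G : SimpleGraph V) (x : V) : Near G (depth G x) (root G x) x := by
  obtain ⟨p, hp⟩ := (reachable_root G x).exists_walk_length_eq_dist
  exact ⟨p, hp.le⟩

lemma depth_root (G : SimpleGraph V) (x : V) : depth G (root G x) = 0 := by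
  rw [depth, root_eq (reachable_root G x), dist_self]

lemma exists_adj_depth {G : SimpleGraph V} {x : V} {k : ℕ} (h : depth G x = k + 1) :
    ∃ y, G.Adj x y ∧ depth G y = k := by
  have hx := (near_root G x).symm
  rw [h] at hx
  rcases near_succ hx with hx | ⟨y, hxy, hy⟩
  · rw [hx, depth_root] at h
    omega
  · refine ⟨y, hxy, ?_⟩
    have h1 := depth_le_add hy.symm
    have h2 := depth_le_succ hxy.symm
    rw [depth_root] at h1
    omega

/-- Descend along depths inside a band. -/
lemma exists_near_of_depth {G : SimpleGraph V} {S : Set V} {k : ℕ} (n : ℕ) {x : V}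
    (hx : depth G x = k + n) (hS : ∀ y, k ≤ depth G y → depth G y ≤ k + n → y ∈ S) :
    ∃ q, depth G q = k ∧ Near (restrictTo G S) n x q := by
  induction n generalizing x with
  | zero => exact ⟨x, hx, Near.refl _ _ _⟩
  | succ n ih =>
    obtain ⟨y, hxy, hy⟩ := exists_adj_depth (k := k + n) (by rw [hx]; rfl)
    obtain ⟨q, hq, hyq⟩ := ih hy fun z h1 h2 => hS z h1 (by omega)
    refine ⟨q, hq, ?_⟩
    have h1 : (restrictTo G S).Adj x y :=
      ⟨hxy, hS x (by omega) (by omega), hS y (by omega) (by omega)⟩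
    rw [add_comm]
    exact (Near.of_adj h1).trans hyq

/-- Short walks starting in the core of a band stay in the band. -/
lemma Near.restrictTo_band {G : SimpleGraph V} {a c ρ n : ℕ} {x q : V} (h : Near G n x q)
    (h1 : a + n ≤ depth G x + ρ) (h2 : depth G x + n ≤ c) :
    Near (restrictTo G {x | a ≤ depth G x + ρ ∧ depth G x ≤ c}) n x q := by
  induction n generalizing x with
  | zero => rw [near_zero.1 h]; exact Near.refl _ _ _
  | succ n ih =>
    rcases near_succ h with rfl | ⟨z, hz, hzq⟩
    · exact Near.refl _ _ _
    · have e1 := depth_le_succ hz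
      have e2 := depth_le_succ hz.symm
      have h3 := ih hzq (by omega) (by omega)
      have h4 : (restrictTo G {x | a ≤ depth G x + ρ ∧ depth G x ≤ c}).Adj x z :=
        ⟨hz, ⟨by omega, by omega⟩, ⟨by omega, by omega⟩⟩
      rw [add_comm]
      exact (Near.of_adj h4).trans h3

end Metric

section Strips

variable {V : Type*}

/-- `Strip G i ℓ H X` says that `H` is obtained from `G` by restricting `i` times to a band of
consecutive depths, and that `X` lies in the cores of these bands. -/
inductive Strip (G : SimpleGraph V) : ℕ → ℕ → SimpleGraph V → Set V → Prop
  | base : Strip G 0 0 G Set.univ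
  | step {i ℓ : ℕ} {H : SimpleGraph V} {X : Set V} (a w ρ ℓ' : ℕ) (h : Strip G i ℓ H X)
      (hρ : ℓ ≤ ρ) (hw : w + ρ ≤ ℓ') :
      Strip G (i + 1) ℓ' (restrictTo H {x | a ≤ depth H x + ρ ∧ depth H x ≤ a + w + ρ})
        (X ∩ {x | a ≤ depth H x ∧ depth H x ≤ a + w})

lemma Strip.le {G H : SimpleGraph V} {i ℓ : ℕ} {X : Set V} (h : Strip G i ℓ H X) : H ≤ G := by
  induction h with
  | base => exact le_rfl
  | step a w ρ ℓ' h hρ hw ih => exact (restrictTo_le _ _).trans ih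

lemma Near.of_core {H : SimpleGraph V} {a w ρ n : ℕ} {x q : V} (h : Near H n x q) (hn : n ≤ ρ)
    (hx : a ≤ depth H x ∧ depth H x ≤ a + w) :
    Near (restrictTo H {x | a ≤ depth H x + ρ ∧ depth H x ≤ a + w + ρ}) n x q :=
  h.restrictTo_band (by omega) (by omega)

lemma not_reachable_below {H : SimpleGraph V} {S : Set V} {x y : V}
    (h : (restrictTo H S).Reachable x y) (hx : x ∈ S) : y ∈ S := by
  obtain ⟨p⟩ := h
  induction p with
  | nil => exact hx
  | cons h p ih => exact ih h.2.2

/-- The vertices of small depth in a component form a connected set. -/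
lemma reachConn_depth_lt (H : SimpleGraph V) (z : V) (k : ℕ) :
    ReachConn H {y | H.Reachable z y ∧ depth H y < k} := by
  obtain ⟨T, hT⟩ : ∃ T, T = {y | H.Reachable z y ∧ depth H y < k} := ⟨_, rfl⟩
  have key : ∀ n, ∀ y ∈ T, depth H y = n → (restrictTo H T).Reachable (root H z) y := by
    intro n
    induction n with
    | zero =>
      intro y hy hn
      rw [hT] at hy
      have : root H z = y := eq_of_depth_eq_zero ((reachable_root H z).trans hy.1)
        (depth_root H z) hn
      rw [this]
    | succ n ih =>
      intro y hy hn
      obtain ⟨y', hadj, hy'⟩ := exists_adj_depth hn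
      have hmem : y' ∈ T := by
        rw [hT] at hy ⊢
        exact ⟨hy.1.trans hadj.reachable, by have := hy.2; omega⟩
      have h1 : (restrictTo H T).Adj y' y := ⟨hadj.symm, hmem, hy⟩
      exact (ih y' hmem hy').trans h1.reachable
  rw [← hT]
  exact fun x hx y hy => (key _ x hx rfl).symm.trans (key _ y hy rfl)

/-- Points of an `i`-fold strip which are not too close have `i` disjoint connected sets
close to all of them and outside of their component. -/
lemma Strip.exists_trees {G H : SimpleGraph V} {i ℓ : ℕ} {X : Set V} (h : Strip G i ℓ H X)
    {ι : Type*} (x : ι → V) (hX : ∀ j, x j ∈ X) (hreach : ∀ j k, H.Reachable (x j) (x k))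
    (j₀ k₀ : ι) (hfar : ¬ Near G (2 * ℓ) (x j₀) (x k₀)) :
    ∃ T : Fin i → Set V, (∀ a, (T a).Nonempty) ∧ (∀ a, ReachConn G (T a)) ∧
      (Pairwise fun a b => Disjoint (T a) (T b)) ∧
      (∀ a, ∀ y ∈ T a, ∀ j, ¬ H.Reachable (x j) y) ∧
      ∀ a j, ∃ q, ∃ y ∈ T a, Near H ℓ (x j) q ∧ G.Adj q y := by
  induction h with
  | base =>
    exact ⟨Fin.elim0, fun a => a.elim0, fun a => a.elim0, fun a => a.elim0, fun a => a.elim0,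
      fun a => a.elim0⟩
  | @step i ℓ H X a w ρ ℓ' h hρ hw ih =>
    set S : Set V := {x | a ≤ depth H x + ρ ∧ depth H x ≤ a + w + ρ} with hS
    have hreach' : ∀ j k, H.Reachable (x j) (x k) := fun j k =>
      (hreach j k).mono (restrictTo_le _ _)
    have hcore : ∀ j, a ≤ depth H (x j) ∧ depth H (x j) ≤ a + w := fun j => (hX j).2
    have hxS : ∀ j, x j ∈ S := fun j => ⟨by have := hcore j; omega, by have := hcore j; omega⟩
    obtain ⟨T, hTne, hTconn, hTdisj, hTreach, hTadj⟩ := ih (fun j => (hX j).1) hreach'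
      fun hn => hfar (hn.mono le_rfl (by omega))
    have haρ : ρ < a := by
      by_contra! hle
      refine hfar ?_
      have h1 : ∀ j, Near G ℓ' (root H (x j)) (x j) := fun j =>
        (near_root H (x j)).mono h.le (by have := hcore j; omega)
      have h2 := (h1 j₀).symm
      rw [root_eq (hreach' j₀ k₀)] at h2
      exact (h2.trans (h1 k₀)).mono le_rfl (by omega)
    obtain ⟨T', hT'⟩ : ∃ T', T' = {y | H.Reachable (x j₀) y ∧ depth H y < a - ρ} := ⟨_, rfl⟩
    have hdisj : ∀ b, Disjoint T' (T b) := by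
      intro b
      rw [Set.disjoint_left]
      intro y hy hyb
      rw [hT'] at hy
      exact hTreach b y hyb j₀ hy.1
    refine ⟨Fin.cons T' T, ?_, ?_, ?_, ?_, ?_⟩
    · refine Fin.cases ?_ hTne
      rw [Fin.cons_zero, hT']
      exact ⟨root H (x j₀), (reachable_root H _).symm, by rw [depth_root]; omega⟩
    · refine Fin.cases ?_ hTconn
      rw [Fin.cons_zero, hT']
      exact (reachConn_depth_lt H (x j₀) (a - ρ)).mono h.le
    · intro b c
      refine Fin.cases ?_ (fun b => ?_) b <;> refine Fin.cases ?_ (fun c => ?_) c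
      · exact fun h => absurd rfl h
      · exact fun _ => hdisj c
      · exact fun _ => (hdisj b).symm
      · exact fun hbc => hTdisj fun e : b = c => hbc (by rw [e])
    · refine Fin.cases ?_ fun b y hy j hr => hTreach b y hy j (hr.mono (restrictTo_le _ _))
      intro y hy j hr
      rw [Fin.cons_zero, hT'] at hy
      have h1 := (not_reachable_below hr (hxS j)).1
      have h2 := hy.2
      omega
    · refine Fin.cases (fun j => ?_) fun b j => ?_
      · have hj := hcore j
        obtain ⟨q, hq, hnear⟩ := exists_near_of_depth (G := H) (S := S) (k := a - ρ)
          (depth H (x j) - (a - ρ)) (x := x j) (by omega)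
          fun y h1 h2 => ⟨by omega, by omega⟩
        obtain ⟨y, hqy, hy⟩ := exists_adj_depth (G := H) (x := q) (k := a - ρ - 1) (by omega)
        refine ⟨q, y, ?_, hnear.mono le_rfl (by omega), h.le hqy⟩
        rw [Fin.cons_zero, hT']
        refine ⟨(hreach' j₀ j).trans ((hnear.reachable.mono (restrictTo_le _ _)).trans
          hqy.reachable), by omega⟩
      · obtain ⟨q, y, hy, hnear, hadj⟩ := hTadj b j
        exact ⟨q, y, hy, (hnear.of_core hρ (hcore j)).mono le_rfl (by omega), hadj⟩

lemma reachConn_ball (H : SimpleGraph V) (ℓ : ℕ) (x : V) : ReachConn H {q | Near H ℓ x q} := by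
  have key : ∀ n, n ≤ ℓ → ∀ y, Near H n x y →
      (restrictTo H {q | Near H ℓ x q}).Reachable x y := by
    intro n
    induction n with
    | zero => intro _ y hy; rw [near_zero.1 hy]
    | succ n ih =>
      intro hn y hy
      rcases near_succ hy.symm with rfl | ⟨z, hz, hzx⟩
      · exact Reachable.refl _
      · have h1 : (restrictTo H {q | Near H ℓ x q}).Adj z y :=
          ⟨hz.symm, hzx.symm.mono le_rfl (by omega), hy.mono le_rfl hn⟩
        exact (ih (by omega) z hzx.symm).trans h1.reachable
  exact fun a ha b hb => (key ℓ le_rfl a ha).symm.trans (key ℓ le_rfl b hb)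

/-- `K` is connected by steps of length at most `r`. -/
def RConn (H : SimpleGraph V) (r : ℕ) (K : Set V) : Prop := ReachConn (powerGraph H r) K

lemma reachable_of_powerGraph {H : SimpleGraph V} {r : ℕ} {x y : V}
    (h : (powerGraph H r).Reachable x y) : H.Reachable x y := by
  obtain ⟨p⟩ := h
  induction p with
  | nil => exact Reachable.refl _
  | cons h p ih => exact h.2.reachable.trans ih

lemma RConn.of_core {H : SimpleGraph V} {a w ρ r : ℕ} {K : Set V} (h : RConn H r K) (hr : r ≤ ρ)
    (hK : ∀ x ∈ K, a ≤ depth H x ∧ depth H x ≤ a + w) :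
    RConn (restrictTo H {x | a ≤ depth H x + ρ ∧ depth H x ≤ a + w + ρ}) r K := by
  intro x hx y hy
  refine Reachable.mono ?_ (h x hx y hy)
  exact fun b c hbc => ⟨⟨hbc.1.1, hbc.1.2.of_core hr (hK _ hbc.2.1)⟩, hbc.2⟩

/-- Sets of points in a `t`-fold strip in a `K_{t,m}`-minor-free graph are small. -/
lemma Strip.ncard_le [Finite V] {G H : SimpleGraph V} {t m ℓ r D : ℕ} {X : Set V} (hm : 2 ≤ m)
    (h : Strip G t ℓ H X) (hG : ¬ HasK t m G) (hD : ∀ v, (G.neighborSet v).ncard ≤ D)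
    {K : Set V} (hKX : K ⊆ X) (hK : RConn H r K) : K.ncard ≤ m * (D + 1) ^ (2 * ℓ) := by
  by_contra! hlt
  obtain ⟨x, hxK, hx⟩ := exists_far (G := G) (s := 2 * ℓ)
    (fun v => ncard_near_le le_rfl hD (2 * ℓ) v) m K hlt
  have hreach : ∀ j k, H.Reachable (x j) (x k) := fun j k =>
    reachable_of_powerGraph ((hK _ (hxK j) _ (hxK k)).mono (restrictTo_le _ _))
  obtain ⟨T, hTne, hTconn, hTdisj, hTreach, hTadj⟩ := h.exists_trees x (fun j => hKX (hxK j))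
    hreach ⟨0, by omega⟩ ⟨1, by omega⟩ (hx (by simp))
  refine hG ⟨T, fun j => {q | Near H ℓ (x j) q}, hTne, fun j => ⟨x j, Near.refl _ _ _⟩, hTconn,
    fun j => (reachConn_ball H ℓ (x j)).mono h.le, hTdisj, fun j k hjk => ?_, fun a j => ?_,
    fun a j => ?_⟩
  · refine Set.disjoint_left.2 fun q hj hk => ?_
    exact hx hjk ((Near.trans hj (Near.symm hk)).mono h.le (by omega))
  · rw [Set.disjoint_left]
    exact fun y hy hyj => hTreach a y hy j (Near.reachable hyj)
  · obtain ⟨q, y, hy, hq, hadj⟩ := hTadj a j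
    exact ⟨y, hy, q, hq, hadj.symm⟩

end Strips

section Clusters

variable {V : Type*}

lemma ReachConn.eq_of_adj {α : Type*} {G : SimpleGraph V} {K : Set V} (hK : ReachConn G K)
    (φ : V → α) (h : ∀ a ∈ K, ∀ b ∈ K, G.Adj a b → φ a = φ b) :
    ∀ x ∈ K, ∀ y ∈ K, φ x = φ y := by
  intro x hx y hy
  obtain ⟨p⟩ := hK x hx y hy
  clear hx hy
  induction p with
  | nil => rfl
  | cons hadj p ih => exact (h _ hadj.2.1 _ hadj.2.2 hadj.1).trans ih

lemma near_of_walk_powerGraph {H : SimpleGraph V} {s : ℕ} {x y : V}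
    (p : (powerGraph H s).Walk x y) : Near H (s * p.length) x y := by
  induction p with
  | nil => exact Near.refl _ _ _
  | cons h p ih =>
    refine (h.2.trans ih).mono le_rfl ?_
    rw [Walk.length_cons, mul_add, mul_one, add_comm]

lemma RConn.mono {H : SimpleGraph V} {r s : ℕ} (hrs : r ≤ s) {K : Set V} (h : RConn H r K) :
    RConn H s K :=
  ReachConn.mono (G := powerGraph H r) (H := powerGraph H s)
    (fun _ _ hab => ⟨hab.1, hab.2.mono le_rfl hrs⟩) h

/-- In a set connected by steps of length `s` any two points are at distance less than
`s` times its size. -/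
lemma RConn.exists_near [Finite V] {H : SimpleGraph V} {s : ℕ} {Q : Set V} (hQ : RConn H s Q)
    {x y : V} (hx : x ∈ Q) (hy : y ∈ Q) : ∃ k < Q.ncard, Near H (s * k) x y := by
  have := Fintype.ofFinite Q
  obtain ⟨p, hp⟩ := ((ReachConn.connected_induce hQ ⟨x, hx⟩).preconnected
    ⟨x, hx⟩ ⟨y, hy⟩).exists_isPath
  refine ⟨p.length, ?_, ?_⟩
  · rw [← Nat.card_coe_set_eq, Nat.card_eq_fintype_card]
    exact hp.length_lt
  · have := near_of_walk_powerGraph (p.map (Embedding.induce Q).toHom)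
    rwa [Walk.length_map] at this

lemma exists_adj_leaving {G : SimpleGraph V} {x y : V} (h : G.Reachable x y) {Q : Set V}
    (hx : x ∈ Q) (hy : y ∉ Q) : ∃ a ∈ Q, ∃ b, b ∉ Q ∧ G.Adj a b := by
  obtain ⟨p⟩ := h
  induction p with
  | nil => exact absurd hx hy
  | @cons u v w hadj p ih =>
    by_cases hv : v ∈ Q
    · exact ih hv hy
    · exact ⟨u, hx, v, hv, hadj⟩

/-- If the clusters of `K` outside `M` are small then `K` is controlled by `K ∩ M`. -/
lemma RConn.ncard_le_of_clusters [Finite V] {H : SimpleGraph V} {s A B b : ℕ} {K M : Set V}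
    (hK : RConn H s K) (hb : ∀ x, {y | Near H (s * A) x y}.ncard ≤ b)
    (hA : ∀ Q ⊆ K \ M, RConn H s Q → Q.ncard ≤ A)
    (hB : RConn H (s * A + s + s * A) (K ∩ M) → (K ∩ M).ncard ≤ B) :
    K.ncard ≤ A + b * B := by
  rcases (K ∩ M).eq_empty_or_nonempty with hKM | ⟨z, hzK, hzM⟩
  · have hKM' : K ⊆ K \ M := fun x hx => ⟨hx, fun hM => Set.notMem_empty x (hKM ▸ ⟨hx, hM⟩)⟩
    exact (hA K hKM' hK).trans (Nat.le_add_right _ _)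
  have hproj : ∀ v ∈ K, ∃ u ∈ K ∩ M, Near H (s * A) v u := by
    intro v hv
    by_cases hvM : v ∈ M
    · exact ⟨v, ⟨hv, hvM⟩, Near.refl _ _ _⟩
    obtain ⟨F, hF⟩ : ∃ F, F = restrictTo (powerGraph H s) (K \ M) := ⟨_, rfl⟩
    obtain ⟨Q, hQ⟩ : ∃ Q, Q = {y | F.Reachable v y} := ⟨_, rfl⟩
    have hQsub : Q ⊆ K \ M := by
      intro y hy
      rw [hQ, hF] at hy
      exact not_reachable_below hy ⟨hv, hvM⟩
    have hvQ : v ∈ Q := by rw [hQ]; exact Reachable.refl _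
    have hQconn : RConn H s Q := by
      have key : ∀ a y, F.Walk a y → a ∈ Q → (restrictTo (powerGraph H s) Q).Reachable a y := by
        intro a y p
        induction p with
        | nil => exact fun _ => Reachable.refl _
        | @cons a c y h p ih =>
          intro ha
          have hc : c ∈ Q := by rw [hQ] at ha ⊢; exact Reachable.trans ha h.reachable
          have h1 : (restrictTo (powerGraph H s) Q).Adj a c := by
            rw [hF] at h
            exact ⟨h.1, ha, hc⟩
          exact h1.reachable.trans (ih hc)
      have key' : ∀ y ∈ Q, (restrictTo (powerGraph H s) Q).Reachable v y := by
        intro y hy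
        have hy' := hy
        rw [hQ] at hy'
        obtain ⟨p⟩ := hy'
        exact key v y p hvQ
      exact fun x hx y hy => (key' x hx).symm.trans (key' y hy)
    obtain ⟨a, haQ, u, huQ, hau⟩ := exists_adj_leaving (hK v hv z hzK) hvQ
      fun hz => (hQsub hz).2 hzM
    have huM : u ∈ M := by
      by_contra hu
      refine huQ ?_
      have h1 : F.Adj a u := by rw [hF]; exact ⟨hau.1, hQsub haQ, hau.2.2, hu⟩
      rw [hQ] at haQ ⊢
      exact Reachable.trans haQ h1.reachable
    obtain ⟨k, hk, hnear⟩ := hQconn.exists_near hvQ haQ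
    refine ⟨u, ⟨hau.2.2, huM⟩, (hnear.trans hau.1.2).mono le_rfl ?_⟩
    have h2 : k + 1 ≤ A := hk.trans_le (hA Q hQsub hQconn)
    calc s * k + s = s * (k + 1) := by ring
      _ ≤ s * A := Nat.mul_le_mul_left _ h2
  choose! π hπ hπnear using hproj
  have hstep : ∀ a ∈ K ∩ M, ∀ b ∈ K ∩ M, Near H (s * A + s + s * A) a b →
      (restrictTo (powerGraph H (s * A + s + s * A)) (K ∩ M)).Reachable a b := by
    intro a ha b hb hab
    by_cases h : a = b
    · rw [h]
    · have : (restrictTo (powerGraph H (s * A + s + s * A)) (K ∩ M)).Adj a b :=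
        ⟨⟨h, hab⟩, ha, hb⟩
      exact this.reachable
  have hconn : RConn H (s * A + s + s * A) (K ∩ M) := by
    have key : ∀ x y, (restrictTo (powerGraph H s) K).Walk x y → x ∈ K →
        (restrictTo (powerGraph H (s * A + s + s * A)) (K ∩ M)).Reachable (π x) (π y) := by
      intro x y p
      induction p with
      | nil => exact fun _ => Reachable.refl _
      | @cons x c y h p ih =>
        intro hx
        refine (hstep _ (hπ x hx) _ (hπ c h.2.2) ?_).trans (ih h.2.2)
        exact ((hπnear x hx).symm.trans h.1.2).trans (hπnear c h.2.2)
    have hself : ∀ x ∈ K ∩ M,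
        (restrictTo (powerGraph H (s * A + s + s * A)) (K ∩ M)).Reachable x (π x) :=
      fun x hx => hstep _ hx _ (hπ x hx.1) ((hπnear x hx.1).mono le_rfl (by omega))
    intro x hx y hy
    obtain ⟨p⟩ := hK x hx.1 y hy.1
    exact ((hself x hx).trans (key x y p hx.1)).trans (hself y hy).symm
  have h1 : K.ncard ≤ b * (K ∩ M).ncard := by
    refine ncard_le_mul_ncard (Set.toFinite _) (Set.toFinite _) π hπ b fun u _ => ?_
    refine le_trans (Set.ncard_le_ncard ?_ (Set.toFinite _)) (hb u)
    rintro v ⟨hv, rfl⟩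
    exact (hπnear v hv).symm
  exact (h1.trans (Nat.mul_le_mul_left _ (hB hconn))).trans (Nat.le_add_left _ _)

lemma succ_div_mod (g : ℕ) {M : ℕ} (hM : 0 < M) :
    ((g + 1) / M = g / M ∧ (g + 1) % M = g % M + 1) ∨
      (g % M + 1 = M ∧ (g + 1) / M = g / M + 1 ∧ (g + 1) % M = 0) := by
  have h1 := Nat.mod_lt g hM
  have h2 := Nat.div_add_mod g M
  by_cases h : g % M + 1 = M
  · right
    have := (Nat.div_mod_unique hM (a := g + 1) (c := 0) (d := g / M + 1)).2
      ⟨by rw [mul_add]; omega, hM⟩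
    exact ⟨h, this.1, this.2⟩
  · left
    exact (Nat.div_mod_unique hM (a := g + 1) (c := g % M + 1) (d := g / M)).2
      ⟨by omega, by omega⟩

lemma depth_div_le {H : SimpleGraph V} {s : ℕ} (hs : 0 < s) {x y : V} (h : Near H s x y) :
    depth H y / s ≤ depth H x / s + 1 := by
  rw [← Nat.add_div_right _ hs]
  exact Nat.div_le_div_right (depth_le_add h)

end Clusters

section Covers

universe u

variable {V : Type u}

/-- There are `N` sets such that every vertex misses at most `n` of them, and the
`r`-connected subsets of each of them inside `X` have size at most `B`. -/
def HasCover (H : SimpleGraph V) (X : Set V) (N n r B : ℕ) : Prop :=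
  ∃ U : Fin N → Set V, (∀ v, {c | v ∉ U c}.ncard ≤ n) ∧
    ∀ c, ∀ K ⊆ U c ∩ X, RConn H r K → K.ncard ≤ B

/-- Steps of size one between integers outside a residue class do not leave the blocks between
two consecutive elements of the class. -/
lemma block_eq_of_step {N c g g' : ℕ} (hc : c < N) (h1 : g' ≤ g + 1) (h2 : g ≤ g' + 1)
    (hg : g % (N + 1) ≠ c) (hg' : g' % (N + 1) ≠ c) :
    (if g % (N + 1) < c then g / (N + 1) else g / (N + 1) + 1) =
      if g' % (N + 1) < c then g' / (N + 1) else g' / (N + 1) + 1 := by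
  wlog h : g ≤ g' generalizing g g'
  · exact (this h2 h1 hg' hg (by omega)).symm
  obtain rfl | rfl : g' = g ∨ g' = g + 1 := by omega
  · rfl
  · rcases succ_div_mod g (Nat.succ_pos N) with ⟨e1, e2⟩ | ⟨e0, e1, e2⟩ <;>
      rw [Nat.succ_eq_add_one] at * <;> rw [e1, e2] <;> rw [e2] at hg' <;> split_ifs <;> omega

lemma div_eq_of_step {N g g' : ℕ} (h1 : g' ≤ g + 1) (h2 : g ≤ g' + 1)
    (hg : g % (N + 1) ≠ N) (hg' : g' % (N + 1) ≠ N) : g / (N + 1) = g' / (N + 1) := by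
  wlog h : g ≤ g' generalizing g g'
  · exact (this h2 h1 hg' hg (by omega)).symm
  obtain rfl | rfl : g' = g ∨ g' = g + 1 := by omega
  · rfl
  · rcases succ_div_mod g (Nat.succ_pos N) with ⟨e1, e2⟩ | ⟨e0, e1, e2⟩ <;>
      rw [Nat.succ_eq_add_one] at * <;> omega

lemma mul_div_bounds (f : ℕ) {s : ℕ} (hs : 0 < s) (M : ℕ) :
    s * (f / s / M * M) + s * (f / s % M) ≤ f ∧
      f < s * (f / s / M * M) + s * (f / s % M) + s := by
  have h1 : f / s / M * M + f / s % M = f / s := by rw [mul_comm]; exact Nat.div_add_mod _ _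
  have h2 := Nat.div_add_mod f s
  have h3 := Nat.mod_lt f hs
  rw [← mul_add, h1]
  omega

/-- Bounded-degree graphs without a `K_{t,m}` minor have good covers. -/
theorem exists_cover (t m D N : ℕ) (hm : 2 ≤ m) (n : ℕ) : ∀ i, i + n = t → ∀ ℓ r, ∃ B,
    ∀ (V : Type u) [Finite V] (G : SimpleGraph V), (∀ v, (G.neighborSet v).ncard ≤ D) →
      ¬ HasK t m G → ∀ H X, Strip G i ℓ H X → HasCover H X N n r B := by
  induction n with
  | zero =>
    intro i hi ℓ r
    rw [add_zero] at hi
    subst hi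
    refine ⟨m * (D + 1) ^ (2 * ℓ), fun V _ G hD hG H X h => ⟨fun _ => Set.univ, by simp, ?_⟩⟩
    exact fun c K hK hconn => h.ncard_le hm hG hD (fun x hx => (hK hx).2) hconn
  | succ n ih =>
    intro i hi ℓ r
    obtain ⟨s, hs⟩ : ∃ s, s = r + 1 := ⟨_, rfl⟩
    have hspos : 0 < s := by omega
    obtain ⟨A, hA⟩ := ih (i + 1) (by omega) (s * N + (ℓ + s)) s
    obtain ⟨R, hR⟩ : ∃ R, R = s * A + s + s * A := ⟨_, rfl⟩
    obtain ⟨B, hB⟩ := ih (i + 1) (by omega) (s + (ℓ + R)) R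
    refine ⟨A + (D + 1) ^ (s * A) * B, fun V _ G hD hG H X hstrip => ?_⟩
    have hzone : ∀ j, HasCover _ _ N n s A := fun j =>
      hA V G hD hG _ _ (hstrip.step (s * (j * (N + 1))) (s * N) (ℓ + s) _ (by omega) le_rfl)
    have hint : ∀ j, HasCover _ _ N n R B := fun j =>
      hB V G hD hG _ _ (hstrip.step (s * (j * (N + 1)) + s * N) s (ℓ + R) _ (by omega) le_rfl)
    choose Z hZmiss hZ using hzone
    choose I hImiss hI using hint
    obtain ⟨g, hg⟩ : ∃ g : V → ℕ, g = fun v => depth H v / s := ⟨_, rfl⟩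
    have hgle : ∀ x y, Near H s x y → g y ≤ g x + 1 := by
      intro x y h
      rw [hg]
      exact depth_div_le hspos h
    have hgmod : ∀ v, g v % (N + 1) ≤ N := fun v =>
      Nat.le_of_lt_succ (Nat.mod_lt _ (Nat.succ_pos N))
    have hbounds := fun v => mul_div_bounds (depth H v) hspos (N + 1)
    obtain ⟨U, hU⟩ : ∃ U : Fin N → Set V, U = fun c => {v |
        (g v % (N + 1) = N ∧ v ∈ I (g v / (N + 1)) c) ∨
        (g v % (N + 1) ≠ N ∧ g v % (N + 1) ≠ c ∧ v ∈ Z (g v / (N + 1)) c)} := ⟨_, rfl⟩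
    refine ⟨U, fun v => ?_, fun c K hK hconn => ?_⟩
    · by_cases hv : g v % (N + 1) = N
      · refine (Set.ncard_le_ncard ?_ (Set.toFinite _)).trans
          ((hImiss (g v / (N + 1)) v).trans (Nat.le_succ n))
        intro c hc hvc
        refine hc ?_
        rw [hU]
        exact Or.inl ⟨hv, hvc⟩
      · have hlt : g v % (N + 1) < N := lt_of_le_of_ne (hgmod v) hv
        refine (Set.ncard_le_ncard (t := insert ⟨g v % (N + 1), hlt⟩
          {c | v ∉ Z (g v / (N + 1)) c}) ?_ (Set.toFinite _)).trans
          ((Set.ncard_insert_le _ _).trans (Nat.succ_le_succ (hZmiss (g v / (N + 1)) v)))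
        intro c hc
        by_contra hcon
        rw [Set.mem_insert_iff, not_or] at hcon
        refine hc ?_
        rw [hU]
        refine Or.inr ⟨hv, fun h => hcon.1 (Fin.ext h.symm), ?_⟩
        exact not_not.1 hcon.2
    · have hconn : RConn H s K := hconn.mono (by omega)
      have hne : ∀ v ∈ K, g v % (N + 1) ≠ c := by
        intro v hv
        have := (hK hv).1
        rw [hU] at this
        rcases this with h | h
        · rw [h.1]; exact c.2.ne'
        · exact h.2.1
      refine hconn.ncard_le_of_clusters (M := {v | g v % (N + 1) = N})
        (fun x => ncard_near_le hstrip.le hD _ x) ?_ ?_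
      · intro Q hQ hQconn
        rcases Q.eq_empty_or_nonempty with rfl | ⟨x, hx⟩
        · simp
        have hconst := ReachConn.eq_of_adj hQconn (fun v => g v / (N + 1))
          fun a ha b hb hab => div_eq_of_step (hgle _ _ hab.2) (hgle _ _ hab.2.symm)
            (hQ ha).2 (hQ hb).2
        have hcore : ∀ v ∈ Q, s * (g x / (N + 1) * (N + 1)) ≤ depth H v ∧
            depth H v ≤ s * (g x / (N + 1) * (N + 1)) + s * N := by
          intro v hv
          have h1 := hbounds v
          have h2 : g v / (N + 1) = g x / (N + 1) := hconst v hv x hx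
          have h3 : s * (g v % (N + 1)) + s ≤ s * N := by
            rw [← Nat.mul_succ]
            exact Nat.mul_le_mul_left _ (lt_of_le_of_ne (hgmod v) (hQ hv).2)
          rw [← h2]
          simp only [hg] at h3 ⊢
          omega
        refine hZ (g x / (N + 1)) c Q (fun v hv => ?_) (RConn.of_core hQconn (by omega) hcore)
        have hvU := (hK (hQ hv).1).1
        rw [hU] at hvU
        rcases hvU with h | h
        · exact absurd h.1 (hQ hv).2
        · refine ⟨?_, (hK (hQ hv).1).2, hcore v hv⟩
          rw [← show g v / (N + 1) = g x / (N + 1) from hconst v hv x hx]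
          exact h.2.2
      · rw [← hR]
        intro hconn'
        rcases (K ∩ {v | g v % (N + 1) = N}).eq_empty_or_nonempty with he | ⟨x, hx⟩
        · rw [he]; simp
        have hblock := ReachConn.eq_of_adj hconn
          (fun v => if g v % (N + 1) < c then g v / (N + 1) else g v / (N + 1) + 1)
          fun a ha b hb hab => block_eq_of_step c.2 (hgle _ _ hab.2) (hgle _ _ hab.2.symm)
            (hne a ha) (hne b hb)
        have hconst : ∀ v ∈ K ∩ {v | g v % (N + 1) = N}, g v / (N + 1) = g x / (N + 1) := by
          intro v hv
          have h1 := hblock v hv.1 x hx.1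
          have h2 : g v % (N + 1) = N := hv.2
          have h3 : g x % (N + 1) = N := hx.2
          simp only [h2, h3, if_neg (not_lt.2 c.2.le)] at h1
          omega
        have hcore : ∀ v ∈ K ∩ {v | g v % (N + 1) = N},
            s * (g x / (N + 1) * (N + 1)) + s * N ≤ depth H v ∧
            depth H v ≤ s * (g x / (N + 1) * (N + 1)) + s * N + s := by
          intro v hv
          have h1 := hbounds v
          have h2 := hconst v hv
          have h3 : g v % (N + 1) = N := hv.2
          simp only [hg] at h2 h3 ⊢
          rw [h2, h3] at h1
          omega
        refine hI (g x / (N + 1)) c _ (fun v hv => ?_) (RConn.of_core hconn' (by omega) hcore)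
        have hvU := (hK hv.1).1
        rw [hU] at hvU
        rcases hvU with h | h
        · refine ⟨?_, (hK hv.1).2, hcore v hv⟩
          rw [← hconst v hv]
          exact h.2
        · exact absurd hv.2 h.1

end Covers

section Coloring

universe u

variable {V : Type u}

/-- Greedy coloring with lists of allowed colors given by a cover. -/
lemma exists_coloring [Finite V] {F : SimpleGraph V} {t n N : ℕ} (hN : t + n ≤ N) (ht : 1 ≤ t)
    (hF : ∀ T : Set V, T.Nonempty → ∃ v ∈ T, {x ∈ T | F.Adj v x}.ncard < t)
    {U : Fin N → Set V} (hU : ∀ v, {c | v ∉ U c}.ncard ≤ n) :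
    ∃ c : V → Fin N, (∀ v, v ∈ U (c v)) ∧ ∀ u v, F.Adj u v → c u ≠ c v := by
  classical
  have main : ∀ (k : ℕ) (S : Set V), S.ncard = k → ∃ c : V → Fin N,
      (∀ v ∈ S, v ∈ U (c v)) ∧ ∀ u ∈ S, ∀ v ∈ S, F.Adj u v → c u ≠ c v := by
    intro k
    induction k with
    | zero =>
      intro S hS
      rw [Set.ncard_eq_zero] at hS
      subst hS
      exact ⟨fun _ => ⟨0, by omega⟩, by simp, by simp⟩
    | succ k ih =>
      intro S hS
      obtain ⟨v, hvS, hv⟩ := hF S (by rw [← Set.ncard_pos]; omega)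
      obtain ⟨c, hcU, hc⟩ := ih (S \ {v}) (by
        rw [Set.ncard_sdiff_singleton_of_mem hvS, hS]; rfl)
      obtain ⟨a, ha⟩ : ∃ a, a ∉ {c | v ∉ U c} ∪ c '' {x ∈ S | F.Adj v x} := by
        by_contra! hall
        have h1 : N ≤ ({c | v ∉ U c} ∪ c '' {x ∈ S | F.Adj v x}).ncard := by
          rw [Set.eq_univ_of_forall hall, Set.ncard_univ, Nat.card_eq_fintype_card,
            Fintype.card_fin]
        have h2 := Set.ncard_union_le {c | v ∉ U c} (c '' {x ∈ S | F.Adj v x})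
        have h3 : (c '' {x ∈ S | F.Adj v x}).ncard ≤ _ := Set.ncard_image_le (Set.toFinite _)
        have h4 := hU v
        omega
      rw [Set.mem_union, not_or] at ha
      have haU : v ∈ U a := not_not.1 ha.1
      have hane : ∀ x ∈ S, F.Adj v x → a ≠ c x := fun x hx hvx e => ha.2 ⟨x, ⟨hx, hvx⟩, e.symm⟩
      refine ⟨Function.update c v a, fun x hx => ?_, fun x hx y hy hxy => ?_⟩
      · by_cases hxv : x = v
        · subst hxv; simpa using haU
        · rw [Function.update_of_ne hxv]
          exact hcU x ⟨hx, hxv⟩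
      · by_cases hxv : x = v
        · subst hxv
          rw [Function.update_self, Function.update_of_ne hxy.ne.symm]
          exact hane y hy hxy
        · by_cases hyv : y = v
          · subst hyv
            rw [Function.update_self, Function.update_of_ne hxv]
            exact (hane x hx hxy.symm).symm
          · rw [Function.update_of_ne hxv, Function.update_of_ne hyv]
            exact hc x ⟨hx, hxv⟩ y ⟨hy, hyv⟩ hxy
  obtain ⟨c, h1, h2⟩ := main _ Set.univ rfl
  exact ⟨c, fun v => h1 v (Set.mem_univ v), fun u v => h2 u (Set.mem_univ u) v (Set.mem_univ v)⟩

end Coloring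

/-- for all `t, m ≥ 1` there is `C ≥ 1` such that every finite graph with no
`K_{t,m}` minor admits a `(2t+2)`-coloring with clustering `C`. -/
theorem stmt8 (t m : ℕ) (ht : 1 ≤ t) (hm : 1 ≤ m) :
    ∃ C : ℕ, 1 ≤ C ∧ ∀ (V : Type) (_ : Fintype V) (G : SimpleGraph V),
      ¬ IsMinorOf (completeBipartiteGraph (Fin t) (Fin m)) G →
      ∃ c : V → Fin (2*t+2), ClusteredColoring G C c := by
  obtain ⟨B, hB⟩ := exists_cover.{0} t (m + 1) (lightBound t (m + 1)) (2 * t + 2) (by omega) t 0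
    (by omega) 0 1
  refine ⟨max B 1, le_max_right _ _, fun V _ G hG => ?_⟩
  have hG' : ¬ HasK t (m + 1) G := fun h => hG (h.of_le (Nat.le_succ m)).isMinorOf
  obtain ⟨L, hLG, hLdeg, hL⟩ := exists_decomposition ht (Nat.le_add_left 1 m) hG'
  obtain ⟨U, hUmiss, hU⟩ := hB V L hLdeg (fun h => hG' (h.mono hLG)) L Set.univ .base
  obtain ⟨c, hcU, hc⟩ := exists_coloring (F := G \ L) (by omega) ht
    (fun T hT => by simpa only [sdiff_adj] using hL T hT) hUmiss
  refine ⟨c, fun S hS hmono => ?_⟩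
  have hLS : RConn L 1 S := by
    intro x hx y hy
    refine Reachable.mono ?_ (reachConn_of_connected_induce hS x hx y hy)
    rintro a b ⟨hab, ha, hb⟩
    have hLab : L.Adj a b := by
      by_contra hn
      exact hc a b ((sdiff_adj _ _ _ _).2 ⟨hab, hn⟩) (hmono a ha b hb)
    exact ⟨⟨hab.ne, .of_adj hLab⟩, ha, hb⟩
  obtain ⟨⟨x, hx⟩⟩ := hS.nonempty
  refine (hU (c x) S (fun v hv => ⟨?_, Set.mem_univ v⟩) hLS).trans (le_max_left _ _)
  rw [hmono x hx v hv]
  exact hcU v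
end

section
/- For every finite graph H, every integer t ≥ 1 and every real α > 0 there exists a real C > 0 satisfying the following: every H-minor-free finite graph G with |E(G)| < (t − α)·|V(G)| contains a t-island of size at most C. -/
open SimpleGraph

section LocalGrowth

variable {V : Type*} [DecidableEq V] (G : SimpleGraph V) [DecidableRel G.Adj]

/-- The vertices of `R` outside `S` that have a neighbor in `S`. -/
def boundaryIn (R S : Finset V) : Finset V :=
  {y ∈ R \ S | ∃ x ∈ S, G.Adj x y}

/-- The vertices reachable from `U` by at most `i` steps inside `R`. -/
def ballIn (R U : Finset V) : ℕ → Finset V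
  | 0 => U
  | i + 1 => ballIn R U i ∪ boundaryIn G R (ballIn R U i)

variable {G}

lemma mem_boundaryIn {R S : Finset V} {y : V} :
    y ∈ boundaryIn G R S ↔ (y ∈ R ∧ y ∉ S) ∧ ∃ x ∈ S, G.Adj x y := by
  simp [boundaryIn]

lemma boundaryIn_subset (R S : Finset V) : boundaryIn G R S ⊆ R := fun _ hy =>
  (mem_boundaryIn.1 hy).1.1

lemma disjoint_boundaryIn (R S : Finset V) : Disjoint S (boundaryIn G R S) :=
  Finset.disjoint_right.2 fun _ hy => (mem_boundaryIn.1 hy).1.2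

lemma ballIn_subset {R U : Finset V} (hU : U ⊆ R) (i : ℕ) : ballIn G R U i ⊆ R := by
  induction i with
  | zero => exact hU
  | succ i ih => exact Finset.union_subset ih (boundaryIn_subset _ _)

lemma subset_ballIn (R U : Finset V) (i : ℕ) : U ⊆ ballIn G R U i := by
  induction i with
  | zero => exact subset_rfl
  | succ i ih => exact ih.trans Finset.subset_union_left

lemma exists_connected_of_mem_ballIn {R U : Finset V} (hU : U ⊆ R) {i : ℕ} {y : V}
    (hy : y ∈ ballIn G R U i) :
    ∃ P ⊆ R, y ∈ P ∧ (∃ u ∈ U, u ∈ P) ∧ (G.induce (P : Set V)).Connected ∧ P.card ≤ i + 1 := by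
  induction i generalizing y with
  | zero =>
    refine ⟨{y}, by simpa using hU hy, by simp, ⟨y, hy, by simp⟩, ?_, by simp⟩
    have : Subsingleton ((({y} : Finset V) : Set V)) := by
      rw [Finset.coe_singleton]; infer_instance
    have : Nonempty ((({y} : Finset V) : Set V)) := ⟨⟨y, by simp⟩⟩
    exact { preconnected := SimpleGraph.Preconnected.of_subsingleton }
  | succ i ih =>
    rcases Finset.mem_union.1 hy with hy | hy
    · obtain ⟨P, h1, h2, h3, h4, h5⟩ := ih hy
      exact ⟨P, h1, h2, h3, h4, by omega⟩
    · obtain ⟨⟨hyR, -⟩, x, hx, hxy⟩ := mem_boundaryIn.1 hy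
      obtain ⟨P, h1, h2, ⟨u, hu, huP⟩, h4, h5⟩ := ih hx
      refine ⟨insert y P, Finset.insert_subset hyR h1, by simp, ⟨u, hu, by simp [huP]⟩, ?_,
        (Finset.card_insert_le _ _).trans (by omega)⟩
      have hset : ((insert y P : Finset V) : Set V) = (P : Set V) ∪ {x, y} := by
        ext z
        simp only [Finset.coe_insert, Set.mem_insert_iff, Finset.mem_coe, Set.mem_union,
          Set.mem_singleton_iff]
        constructor
        · tauto
        · rintro (h | rfl | h) <;> tauto
      rw [hset]
      exact SimpleGraph.induce_union_connected h4.preconnected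
        (SimpleGraph.induce_pair_connected_of_adj hxy).preconnected ⟨x, by simpa using h2, by simp⟩

lemma two_mul_card_ballIn_gt {R U : Finset V} {q m : ℕ} (hq : 0 < q) (hR : R.card ≤ 2 ^ m)
    (hexp : ∀ S ⊆ R, S.Nonempty → 2 * S.card ≤ R.card → S.card < q * (boundaryIn G R S).card)
    (hU : U ⊆ R) (hne : U.Nonempty) : R.card < 2 * (ballIn G R U (q * m)).card := by
  have growth : ∀ i, R.card < 2 * (ballIn G R U i).card ∨
      (1 + 1 / (q : ℝ)) ^ i ≤ (ballIn G R U i).card := by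
    intro i
    induction i with
    | zero => right; simpa [ballIn] using hne
    | succ i ih =>
      have hcard : (ballIn G R U (i + 1)).card =
          (ballIn G R U i).card + (boundaryIn G R (ballIn G R U i)).card :=
        Finset.card_union_of_disjoint (disjoint_boundaryIn _ _)
      rcases lt_or_ge R.card (2 * (ballIn G R U i).card) with h | h
      · left; omega
      · right
        have hlt := hexp _ (ballIn_subset hU i) (hne.mono (subset_ballIn R U i)) h
        have hpow := ih.resolve_left (by omega)
        have hq' : (0 : ℝ) < q := by exact_mod_cast hq
        have hlt' : ((ballIn G R U i).card : ℝ) / q ≤ (boundaryIn G R (ballIn G R U i)).card := by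
          rw [div_le_iff₀ hq', mul_comm]
          exact_mod_cast hlt.le
        calc (1 + 1 / (q : ℝ)) ^ (i + 1) = (1 + 1 / (q : ℝ)) ^ i * (1 + 1 / (q : ℝ)) := pow_succ _ _
          _ ≤ (ballIn G R U i).card * (1 + 1 / (q : ℝ)) := by gcongr
          _ = (ballIn G R U i).card + (ballIn G R U i).card / (q : ℝ) := by ring
          _ ≤ _ := by rw [hcard]; push_cast; gcongr
  rcases growth (q * m) with h | h
  · exact h
  have hq' : (0 : ℝ) < q := by exact_mod_cast hq
  have htwo : (2 : ℝ) ≤ (1 + 1 / (q : ℝ)) ^ q := by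
    have h0 : (0 : ℝ) ≤ 1 / q := by positivity
    have := one_add_mul_le_pow (a := 1 / (q : ℝ)) (by linarith) q
    have h1 : (q : ℝ) * (1 / q) = 1 := by field_simp
    linarith
  have h2 : (2 : ℝ) ^ m ≤ (ballIn G R U (q * m)).card := by
    refine le_trans ?_ h
    rw [pow_mul]
    gcongr
  have h3 : 2 ^ m ≤ (ballIn G R U (q * m)).card := by exact_mod_cast h2
  have : 0 < (2 : ℕ) ^ m := by positivity
  omega

/-- If every at most half-size subset of `R` expands, some small connected subset of `R` meets all
the given subsets. -/
lemma exists_connected_meeting {R : Finset V} {q m : ℕ} (hq : 0 < q) (hR : R.card ≤ 2 ^ m)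
    (hexp : ∀ S ⊆ R, S.Nonempty → 2 * S.card ≤ R.card → S.card < q * (boundaryIn G R S).card)
    (hne : R.Nonempty) {ι : Type*} (𝒜 : Finset ι) (U : ι → Finset V)
    (hU : ∀ a ∈ 𝒜, U a ⊆ R ∧ (U a).Nonempty) :
    ∃ T ⊆ R, (G.induce (T : Set V)).Connected ∧ T.card ≤ 1 + 2 * (q * m) * 𝒜.card ∧
      ∀ a ∈ 𝒜, ∃ u ∈ U a, u ∈ T := by
  classical
  obtain ⟨v, hv⟩ := hne
  have hvR : {v} ⊆ R := by simpa using hv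
  suffices ∃ T ⊆ R, v ∈ T ∧ (G.induce (T : Set V)).Connected ∧
      T.card ≤ 1 + 2 * (q * m) * 𝒜.card ∧ ∀ a ∈ 𝒜, ∃ u ∈ U a, u ∈ T by
    obtain ⟨T, h1, -, h⟩ := this
    exact ⟨T, h1, h⟩
  induction 𝒜 using Finset.induction_on with
  | empty =>
    obtain ⟨P, h1, h2, -, h4, h5⟩ :=
      exists_connected_of_mem_ballIn (G := G) (i := 0) hvR (y := v) (by simp [ballIn])
    exact ⟨P, h1, h2, h4, by simpa using h5, by simp⟩
  | insert a 𝒜 ha ih =>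
    obtain ⟨T, hTR, hvT, hT, hTc, hTU⟩ := ih fun b hb => hU b (Finset.mem_insert_of_mem hb)
    obtain ⟨hUR, hUne⟩ := hU a (Finset.mem_insert_self _ _)
    have hb1 := two_mul_card_ballIn_gt hq hR hexp hvR (Finset.singleton_nonempty v)
    have hb2 := two_mul_card_ballIn_gt hq hR hexp hUR hUne
    obtain ⟨y, hy⟩ : (ballIn G R {v} (q * m) ∩ ballIn G R (U a) (q * m)).Nonempty := by
      refine Finset.inter_nonempty_of_card_lt_card_add_card (ballIn_subset hvR _)
        (ballIn_subset hUR _) ?_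
      omega
    rw [Finset.mem_inter] at hy
    obtain ⟨P, hPR, hyP, ⟨v', hv', hvP⟩, hP, hPc⟩ := exists_connected_of_mem_ballIn hvR hy.1
    obtain rfl := Finset.mem_singleton.1 hv'
    obtain ⟨Q, hQR, hyQ, ⟨u, hu, huQ⟩, hQ, hQc⟩ := exists_connected_of_mem_ballIn hUR hy.2
    have hPQ : (G.induce ((P ∪ Q : Finset V) : Set V)).Connected := by
      rw [Finset.coe_union]
      exact SimpleGraph.induce_union_connected hP.preconnected hQ.preconnected ⟨y, hyP, hyQ⟩
    refine ⟨T ∪ (P ∪ Q), Finset.union_subset hTR (Finset.union_subset hPR hQR), by simp [hvT],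
      ?_, ?_, ?_⟩
    · rw [Finset.coe_union]
      exact SimpleGraph.induce_union_connected hT.preconnected hPQ.preconnected
        ⟨v', hvT, by simp [hvP]⟩
    · have h1 : (P ∪ Q).card + 1 ≤ P.card + Q.card := by
        rw [← Finset.card_union_add_card_inter]
        have : 0 < (P ∩ Q).card := Finset.card_pos.2 ⟨y, by simp [hyP, hyQ]⟩
        omega
      have h2 : (T ∪ (P ∪ Q)).card + 1 ≤ T.card + (P ∪ Q).card := by
        rw [← Finset.card_union_add_card_inter T]
        have : 0 < (T ∩ (P ∪ Q)).card := Finset.card_pos.2 ⟨v', by simp [hvT, hvP]⟩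
        omega
      rw [Finset.card_insert_of_notMem ha, mul_add]
      omega
    · intro b hb
      rcases Finset.mem_insert.1 hb with rfl | hb
      · exact ⟨u, hu, by simp [huQ]⟩
      · obtain ⟨w, hw, hwT⟩ := hTU b hb
        exact ⟨w, hw, by simp [hwT]⟩

end LocalGrowth

section Separation

variable {V : Type*}

/-- The members of `𝒜` are the branch sets of a model of a complete graph in `G`. -/
structure IsCompleteModel (G : SimpleGraph V) (𝒜 : Finset (Finset V)) : Prop where
  connected : ∀ A ∈ 𝒜, (G.induce (A : Set V)).Connected
  disjoint : (𝒜 : Set (Finset V)).Pairwise Disjoint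
  adj : (𝒜 : Set (Finset V)).Pairwise fun A B => ∃ u ∈ A, ∃ v ∈ B, G.Adj u v

lemma IsCompleteModel.nonempty {G : SimpleGraph V} {𝒜 : Finset (Finset V)}
    (h : IsCompleteModel G 𝒜) {A : Finset V} (hA : A ∈ 𝒜) : A.Nonempty := by
  obtain ⟨x⟩ := (h.connected A hA).nonempty
  exact ⟨x, x.2⟩

lemma IsCompleteModel.mono {G : SimpleGraph V} {𝒜 ℬ : Finset (Finset V)}
    (h : IsCompleteModel G 𝒜) (hsub : ℬ ⊆ 𝒜) : IsCompleteModel G ℬ where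
  connected A hA := h.connected A (hsub hA)
  disjoint := h.disjoint.mono (by exact_mod_cast hsub)
  adj := h.adj.mono (by exact_mod_cast hsub)

lemma IsCompleteModel.insert [DecidableEq V] {G : SimpleGraph V} {𝒜 : Finset (Finset V)}
    (h : IsCompleteModel G 𝒜) {T : Finset V} (hT : (G.induce (T : Set V)).Connected)
    (hdisj : ∀ A ∈ 𝒜, Disjoint A T) (hadj : ∀ A ∈ 𝒜, ∃ u ∈ A, ∃ v ∈ T, G.Adj u v) :
    IsCompleteModel G (insert T 𝒜) where
  connected A hA := by
    rcases Finset.mem_insert.1 hA with rfl | hA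
    exacts [hT, h.connected A hA]
  disjoint := by
    rw [Finset.coe_insert]
    exact h.disjoint.insert fun A hA _ => ⟨(hdisj A hA).symm, hdisj A hA⟩
  adj := by
    rw [Finset.coe_insert]
    refine h.adj.insert fun A hA _ => ⟨?_, hadj A hA⟩
    obtain ⟨u, hu, v, hv, huv⟩ := hadj A hA
    exact ⟨v, hv, u, hu, huv.symm⟩

lemma IsCompleteModel.isMinorOf {W : Type*} [Fintype W] (H : SimpleGraph W) {G : SimpleGraph V}
    {𝒜 : Finset (Finset V)} (h : IsCompleteModel G 𝒜) (hcard : Fintype.card W ≤ 𝒜.card) :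
    IsMinorOf H G := by
  obtain ⟨f⟩ := Function.Embedding.nonempty_of_card_le (α := W) (β := 𝒜) (by simpa using hcard)
  have hne : ∀ {a b}, a ≠ b → (f a : Finset V) ≠ f b := fun hab heq =>
    hab (f.injective (Subtype.ext heq))
  refine ⟨fun w => ((f w : Finset V) : Set V), fun w => h.nonempty (f w).2,
    fun w => h.connected _ (f w).2, fun a b hab => ?_, fun a b hab => ?_⟩
  · exact Finset.disjoint_coe.2 (h.disjoint (f a).2 (f b).2 (hne hab))
  · exact h.adj (f a).2 (f b).2 (hne hab.ne)

/-- A partial separation of `M`: the side `D` is cut off from the rest of `M` by the set `Z` and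
by the branch sets in `𝒜`, each having at most `s` vertices. -/
structure IsPartialSeparation [DecidableEq V] (G : SimpleGraph V) (M : Finset V) (q s : ℕ)
    (D Z : Finset V) (𝒜 : Finset (Finset V)) : Prop where
  subset_side : D ⊆ M
  subset_cut : Z ⊆ M
  subset_branch : ∀ A ∈ 𝒜, A ⊆ M
  disjoint_cut : Disjoint D Z
  disjoint_side_branch : ∀ A ∈ 𝒜, Disjoint D A
  disjoint_cut_branch : ∀ A ∈ 𝒜, Disjoint Z A
  not_adj : ∀ x ∈ D, ∀ y ∈ M \ (D ∪ Z ∪ 𝒜.biUnion id), ¬ G.Adj x y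
  card_cut : q * Z.card ≤ D.card
  card_side : 4 * D.card ≤ 3 * M.card
  model : IsCompleteModel G 𝒜
  card_branch : ∀ A ∈ 𝒜, A.card ≤ s

/-- A set of vertices in a graph without large complete minors has a small balanced separator,
namely the complement in `M` of the two sides `D` and `R`. -/
theorem exists_balanced_separation [Fintype V] [DecidableEq V] {G : SimpleGraph V} {h : ℕ}
    (hG : ∀ 𝒜, IsCompleteModel G 𝒜 → 𝒜.card < h) (M : Finset V) {q m : ℕ} (hq : 0 < q)
    (hM : M.card ≤ 2 ^ m) :
    ∃ D ⊆ M, ∃ R ⊆ M, Disjoint D R ∧ (∀ x ∈ D, ∀ y ∈ R, ¬ G.Adj x y) ∧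
      4 * D.card ≤ 3 * M.card ∧ 4 * R.card ≤ 3 * M.card ∧
      q * M.card ≤ q * (D.card + R.card) + M.card + q * (h * (1 + 2 * (q * m) * h)) := by
  classical
  set s := 1 + 2 * (q * m) * h with hs
  let states : Finset (Finset V × Finset V × Finset (Finset V)) :=
    {p | IsPartialSeparation G M q s p.1 p.2.1 p.2.2}
  have hstates : states.Nonempty := by
    refine ⟨(∅, ∅, ∅), ?_⟩
    simp only [states, Finset.mem_filter, Finset.mem_univ, true_and]
    exact { subset_side := by simp, subset_cut := by simp, subset_branch := by simp,
            disjoint_cut := by simp, disjoint_side_branch := by simp,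
            disjoint_cut_branch := by simp, not_adj := by simp, card_cut := by simp,
            card_side := by simp, card_branch := by simp,
            model := { connected := by simp, disjoint := by simp, adj := by simp } }
  obtain ⟨⟨D, Z, 𝒜⟩, hmem, hmax⟩ :=
    Finset.exists_max_image states (fun p => 2 * p.1.card + p.2.2.card) hstates
  simp only [states, Finset.mem_filter, Finset.mem_univ, true_and] at hmem
  replace hmax : ∀ D' Z' 𝒜', IsPartialSeparation G M q s D' Z' 𝒜' →
      2 * D'.card + 𝒜'.card ≤ 2 * D.card + 𝒜.card := fun D' Z' 𝒜' h' =>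
    hmax (D', Z', 𝒜') (by simpa [states] using h')
  have h𝒜 := hG 𝒜 hmem.model
  set R := M \ (D ∪ Z ∪ 𝒜.biUnion id) with hR
  have mem_R : ∀ y, y ∈ R ↔ y ∈ M ∧ y ∉ D ∧ y ∉ Z ∧ ∀ A ∈ 𝒜, y ∉ A := by
    intro y
    simp only [hR, Finset.mem_sdiff, Finset.mem_union, Finset.mem_biUnion, id]
    push Not
    tauto
  have hRM : R ⊆ M := Finset.sdiff_subset
  have hDR : Disjoint D R := Finset.disjoint_right.2 fun y hy => ((mem_R y).1 hy).2.1
  have hDRc : D.card + R.card ≤ M.card := by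
    rw [← Finset.card_union_of_disjoint hDR]
    exact Finset.card_le_card (Finset.union_subset hmem.subset_side hRM)
  refine ⟨D, hmem.subset_side, R, hRM, hDR, hmem.not_adj, hmem.card_side, ?_, ?_⟩
  swap
  · have h1 : M.card ≤ D.card + Z.card + h * s + R.card := by
      have : M ⊆ D ∪ Z ∪ 𝒜.biUnion id ∪ R := by
        rw [hR, Finset.union_sdiff_self_eq_union]
        exact Finset.subset_union_right
      refine (Finset.card_le_card this).trans ?_
      have hb : (𝒜.biUnion id).card ≤ 𝒜.card * s :=
        Finset.card_biUnion_le_card_mul _ _ _ hmem.card_branch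
      have hb' : 𝒜.card * s ≤ h * s := Nat.mul_le_mul_right _ h𝒜.le
      have e1 := Finset.card_union_le (D ∪ Z ∪ 𝒜.biUnion id) R
      have e2 := Finset.card_union_le (D ∪ Z) (𝒜.biUnion id)
      have e3 := Finset.card_union_le D Z
      omega
    have h2 := Nat.mul_le_mul_left q h1
    have h3 := hmem.card_cut
    have h4 := Finset.card_le_card hmem.subset_side
    simp only [mul_add] at h2 ⊢
    linarith
  by_contra! hbig
  -- every branch set has a neighbor in `R`, as otherwise it could be moved to `D`
  have hnbr : ∀ A ∈ 𝒜, ({y ∈ R | ∃ x ∈ A, G.Adj x y}).Nonempty := by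
    intro A hA
    by_contra hempty
    rw [Finset.not_nonempty_iff_eq_empty, Finset.filter_eq_empty_iff] at hempty
    push Not at hempty
    have hDA := hmem.disjoint_side_branch A hA
    have hcard : (D ∪ A).card = D.card + A.card := Finset.card_union_of_disjoint hDA
    have hApos := (hmem.model.nonempty hA).card_pos
    have hAR : Disjoint (D ∪ A) R := by
      rw [Finset.disjoint_union_left]
      exact ⟨hDR, Finset.disjoint_right.2 fun y hy => ((mem_R y).1 hy).2.2.2 A hA⟩
    have hle : (D ∪ A).card + R.card ≤ M.card := by
      rw [← Finset.card_union_of_disjoint hAR]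
      exact Finset.card_le_card (Finset.union_subset
        (Finset.union_subset hmem.subset_side (hmem.subset_branch A hA)) hRM)
    have := hmax (D ∪ A) Z (𝒜.erase A)
      { subset_side := Finset.union_subset hmem.subset_side (hmem.subset_branch A hA)
        subset_cut := hmem.subset_cut
        subset_branch := fun B hB => hmem.subset_branch B (Finset.mem_of_mem_erase hB)
        disjoint_cut := Finset.disjoint_union_left.2
          ⟨hmem.disjoint_cut, (hmem.disjoint_cut_branch A hA).symm⟩
        disjoint_side_branch := fun B hB => Finset.disjoint_union_left.2
          ⟨hmem.disjoint_side_branch B (Finset.mem_of_mem_erase hB),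
            hmem.model.disjoint hA (Finset.mem_of_mem_erase hB) (Finset.ne_of_mem_erase hB).symm⟩
        disjoint_cut_branch := fun B hB => hmem.disjoint_cut_branch B (Finset.mem_of_mem_erase hB)
        not_adj := by
          intro x hx y hy
          have hyR : y ∈ R := by
            rw [mem_R]
            simp only [Finset.mem_sdiff, Finset.mem_union, Finset.mem_biUnion, Finset.mem_erase,
              id] at hy
            push Not at hy
            refine ⟨hy.1, fun h => hy.2.1.1.1 h, hy.2.1.2, fun B hB hyB => ?_⟩
            by_cases hBA : B = A
            · subst hBA; exact hy.2.1.1.2 hyB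
            · exact hy.2.2 B ⟨hBA, hB⟩ hyB
          rcases Finset.mem_union.1 hx with hx | hx
          · exact hmem.not_adj x hx y hyR
          · exact hempty hyR x hx
        card_cut := by have := hmem.card_cut; omega
        card_side := by omega
        model := hmem.model.mono (Finset.erase_subset _ _)
        card_branch := fun B hB => hmem.card_branch B (Finset.mem_of_mem_erase hB) }
    rw [Finset.card_erase_of_mem hA] at this
    omega
  -- `R` expands, as otherwise a set with small boundary could be moved to `D`
  have hexp : ∀ S ⊆ R, S.Nonempty → 2 * S.card ≤ R.card →
      S.card < q * (boundaryIn G R S).card := by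
    intro S hSR hS hS2
    by_contra! hle
    have hDS : Disjoint D S := hDR.mono_right hSR
    have hcard : (D ∪ S).card = D.card + S.card := Finset.card_union_of_disjoint hDS
    have hbR := boundaryIn_subset (G := G) R S
    have hZc := Finset.card_union_le Z (boundaryIn G R S)
    have := hmax (D ∪ S) (Z ∪ boundaryIn G R S) 𝒜
      { subset_side := Finset.union_subset hmem.subset_side (hSR.trans hRM)
        subset_cut := Finset.union_subset hmem.subset_cut (hbR.trans hRM)
        subset_branch := hmem.subset_branch
        disjoint_cut := by
          rw [Finset.disjoint_union_left, Finset.disjoint_union_right, Finset.disjoint_union_right]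
          refine ⟨⟨hmem.disjoint_cut, hDR.mono_right hbR⟩, ?_, disjoint_boundaryIn R S⟩
          exact Finset.disjoint_left.2 fun y hy => ((mem_R y).1 (hSR hy)).2.2.1
        disjoint_side_branch := fun A hA => Finset.disjoint_union_left.2
          ⟨hmem.disjoint_side_branch A hA,
            Finset.disjoint_left.2 fun y hy => ((mem_R y).1 (hSR hy)).2.2.2 A hA⟩
        disjoint_cut_branch := fun A hA => Finset.disjoint_union_left.2
          ⟨hmem.disjoint_cut_branch A hA,
            Finset.disjoint_left.2 fun y hy => ((mem_R y).1 (hbR hy)).2.2.2 A hA⟩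
        not_adj := by
          intro x hx y hy
          simp only [Finset.mem_sdiff, Finset.mem_union, Finset.mem_biUnion, id] at hy
          push Not at hy
          obtain ⟨hyM, ⟨⟨hyD, hyS⟩, hyZ, hyb⟩, hyA⟩ := hy
          have hyR : y ∈ R := (mem_R y).2 ⟨hyM, hyD, hyZ, hyA⟩
          rcases Finset.mem_union.1 hx with hx | hx
          · exact hmem.not_adj x hx y hyR
          · exact fun hxy => hyb (mem_boundaryIn.2 ⟨⟨hyR, hyS⟩, x, hx, hxy⟩)
        card_cut := by
          have h1 := hmem.card_cut
          have h2 := Nat.mul_le_mul_left q hZc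
          rw [mul_add] at h2
          omega
        card_side := by omega
        model := hmem.model
        card_branch := hmem.card_branch }
    have := hS.card_pos
    omega
  have hRne : R.Nonempty := Finset.card_pos.1 (by omega)
  -- so a further branch set can be found in `R`
  obtain ⟨T, hTR, hT, hTc, hTU⟩ := exists_connected_meeting hq
    ((Finset.card_le_card hRM).trans hM) hexp hRne 𝒜 (fun A => {y ∈ R | ∃ x ∈ A, G.Adj x y})
    fun A hA => ⟨Finset.filter_subset _ _, hnbr A hA⟩
  have hTA : ∀ A ∈ 𝒜, Disjoint A T := fun A hA =>
    Finset.disjoint_right.2 fun y hy => ((mem_R y).1 (hTR hy)).2.2.2 A hA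
  have hTne : T.Nonempty := by
    obtain ⟨x⟩ := hT.nonempty
    exact ⟨x, x.2⟩
  have hTnot : T ∉ 𝒜 := fun h =>
    hTne.ne_empty (Finset.disjoint_self_iff_empty _ |>.1 (hTA T h))
  have hTs : T.card ≤ s := hTc.trans (by rw [hs]; gcongr)
  have := hmax D Z (insert T 𝒜)
    { subset_side := hmem.subset_side
      subset_cut := hmem.subset_cut
      subset_branch := Finset.forall_mem_insert _ _ _ |>.2 ⟨hTR.trans hRM, hmem.subset_branch⟩
      disjoint_cut := hmem.disjoint_cut
      disjoint_side_branch := Finset.forall_mem_insert _ _ _ |>.2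
        ⟨hDR.mono_right hTR, hmem.disjoint_side_branch⟩
      disjoint_cut_branch := Finset.forall_mem_insert _ _ _ |>.2
        ⟨Finset.disjoint_right.2 fun y hy => ((mem_R y).1 (hTR hy)).2.2.1,
          hmem.disjoint_cut_branch⟩
      not_adj := fun x hx y hy => by
        refine hmem.not_adj x hx y (Finset.sdiff_subset_sdiff subset_rfl ?_ hy)
        exact Finset.union_subset_union subset_rfl
          (Finset.biUnion_subset_biUnion_of_subset_left _ (Finset.subset_insert _ _))
      card_cut := hmem.card_cut
      card_side := hmem.card_side
      model := hmem.model.insert hT hTA fun A hA => by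
        obtain ⟨y, hy, hyT⟩ := hTU A hA
        obtain ⟨x, hx, hxy⟩ := (Finset.mem_filter.1 hy).2
        exact ⟨x, hx, y, hyT, hxy⟩
      card_branch := Finset.forall_mem_insert _ _ _ |>.2 ⟨hTs, hmem.card_branch⟩ }
  rw [Finset.card_insert_of_notMem hTnot] at this
  omega

end Separation

section Islands

variable {V : Type*} [Finite V] {G : SimpleGraph V}

lemma edgesTouching_union [DecidableEq V] {A B : Finset V} (hAB : Disjoint A B)
    (hadj : ∀ x ∈ A, ∀ y ∈ B, ¬ G.Adj x y) :
    edgesTouching G (A : Set V) + edgesTouching G (B : Set V) =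
      edgesTouching G ((A ∪ B : Finset V) : Set V) := by
  unfold edgesTouching
  rw [← Set.ncard_union_eq _ (Set.toFinite _) (Set.toFinite _)]
  · congr 1
    ext e
    simp only [Set.mem_union, Set.mem_ofPred_eq, Finset.mem_coe, Finset.mem_union]
    constructor
    · rintro (⟨h, v, hv, hve⟩ | ⟨h, v, hv, hve⟩)
      exacts [⟨h, v, Or.inl hv, hve⟩, ⟨h, v, Or.inr hv, hve⟩]
    · rintro ⟨h, v, hv | hv, hve⟩
      exacts [Or.inl ⟨h, v, hv, hve⟩, Or.inr ⟨h, v, hv, hve⟩]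
  · rw [Set.disjoint_left]
    rintro e ⟨he, x, hx, hxe⟩ ⟨-, y, hy, hye⟩
    have hxy : x ≠ y := fun h => Finset.disjoint_left.1 hAB hx (h ▸ hy)
    rw [(Sym2.mem_and_mem_iff hxy).1 ⟨hxe, hye⟩] at he
    exact hadj x hx y hy he

lemma mul_card_le_edgesTouching [DecidableEq V] {t : ℕ} (M : Finset V)
    (hM : ∀ S ⊆ M, ¬ IsIsland G t (S : Set V)) :
    t * M.card ≤ edgesTouching G (M : Set V) := by
  induction M using Finset.strongInduction with
  | H M ih =>
    rcases M.eq_empty_or_nonempty with rfl | hne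
    · simp
    have hnot := hM M subset_rfl
    simp only [IsIsland, not_and, not_forall, not_lt] at hnot
    obtain ⟨v, hv, htv⟩ := hnot hne
    have hv : v ∈ M := hv
    have h1 := ih (M.erase v) (Finset.erase_ssubset hv) fun S hS =>
      hM S (hS.trans (Finset.erase_subset _ _))
    have h2 : t ≤ ((fun u => s(v, u)) '' (G.neighborSet v \ (M : Set V))).ncard := by
      rwa [Set.ncard_image_of_injective _ fun a b hab => Sym2.congr_right.1 hab]
    have h3 : edgesTouching G ((M.erase v : Finset V) : Set V) +
        ((fun u => s(v, u)) '' (G.neighborSet v \ (M : Set V))).ncard ≤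
        edgesTouching G (M : Set V) := by
      unfold edgesTouching
      rw [← Set.ncard_union_eq _ (Set.toFinite _) (Set.toFinite _)]
      · refine Set.ncard_le_ncard ?_ (Set.toFinite _)
        rintro e (⟨he, x, hx, hxe⟩ | ⟨u, ⟨hu, huM⟩, rfl⟩)
        · exact ⟨he, x, Finset.mem_of_mem_erase hx, hxe⟩
        · exact ⟨hu, v, hv, by simp⟩
      · rw [Set.disjoint_left]
        rintro e ⟨he, x, hx, hxe⟩ ⟨u, ⟨hu, huM⟩, rfl⟩
        have hx := Finset.mem_erase.1 (Finset.mem_coe.1 hx)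
        rcases Sym2.mem_iff.1 hxe with rfl | rfl
        exacts [hx.1 rfl, huM hx.2]
    have h4 : M.card = (M.erase v).card + 1 := (Finset.card_erase_add_one hv).symm
    rw [h4, mul_add, mul_one]
    omega

/-- If `G` has neither a large complete minor nor a small `t`-island, then almost all of every set
`M` is covered by a set touching many edges. -/
lemma exists_mul_card_le_edgesTouching [Fintype V] [DecidableEq V] {t h k₀ : ℕ} (hk₀ : 0 < k₀)
    (hnum : ∀ k ≥ k₀, ((k * (k + 1) * (h * (1 + 2 * (k * (k + 1) * (k + 1)) * h)) : ℕ) : ℝ)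
      ≤ (4 / 3 : ℝ) ^ k)
    (hG : ∀ 𝒜, IsCompleteModel G 𝒜 → 𝒜.card < h)
    (hisl : ∀ S : Finset V, (S.card : ℝ) ≤ (4 / 3 : ℝ) ^ k₀ → ¬ IsIsland G t (S : Set V))
    {k : ℕ} (hk : k₀ ≤ k) (M : Finset V) (hM : (M.card : ℝ) ≤ (4 / 3 : ℝ) ^ k) :
    ∃ Y ⊆ M, (M.card : ℝ) * (1 - 2 * (1 / (k₀ : ℝ) - 1 / k)) ≤ Y.card ∧
      t * Y.card ≤ edgesTouching G (Y : Set V) := by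
  induction k, hk using Nat.le_induction generalizing M with
  | base =>
    refine ⟨M, subset_rfl, by simp, mul_card_le_edgesTouching M fun S hS => hisl S ?_⟩
    exact le_trans (by exact_mod_cast Finset.card_le_card hS) hM
  | succ k hk ih =>
    have hkpos : (0 : ℝ) < k := by exact_mod_cast hk₀.trans_le hk
    have hdiff : 1 / (k : ℝ) - 1 / ((k + 1 : ℕ) : ℝ) = 1 / (k * (k + 1)) := by
      push_cast
      field_simp
      ring
    by_cases hsmall : (M.card : ℝ) ≤ (4 / 3 : ℝ) ^ k
    · obtain ⟨Y, hY, hc, he⟩ := ih M hsmall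
      refine ⟨Y, hY, le_trans ?_ hc, he⟩
      have : 0 ≤ 1 / ((k : ℝ) * (k + 1)) := by positivity
      gcongr
      linarith
    push Not at hsmall
    have hq : 0 < k * (k + 1) := by have := hk₀.trans_le hk; positivity
    have hMpow : M.card ≤ 2 ^ (k + 1) := by
      have : (4 / 3 : ℝ) ^ (k + 1) ≤ 2 ^ (k + 1) := by gcongr; norm_num
      exact_mod_cast hM.trans this
    obtain ⟨D, hDM, R, hRM, hDR, hadj, hD, hR, hsep⟩ :=
      exists_balanced_separation hG M hq hMpow
    have hpart : ∀ S : Finset V, 4 * S.card ≤ 3 * M.card → (S.card : ℝ) ≤ (4 / 3 : ℝ) ^ k := by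
      intro S hS
      have hS' : (4 : ℝ) * S.card ≤ 3 * M.card := by exact_mod_cast hS
      rw [pow_succ] at hM
      linarith
    obtain ⟨Y₁, hY₁, hc₁, he₁⟩ := ih D (hpart D hD)
    obtain ⟨Y₂, hY₂, hc₂, he₂⟩ := ih R (hpart R hR)
    have hdisj : Disjoint Y₁ Y₂ := hDR.mono hY₁ hY₂
    refine ⟨Y₁ ∪ Y₂, Finset.union_subset (hY₁.trans hDM) (hY₂.trans hRM), ?_, ?_⟩
    · rw [Finset.card_union_of_disjoint hdisj]
      have hnum' := (hnum k hk).trans hsmall.le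
      have hsep' : (k * (k + 1) : ℝ) * M.card ≤
          (k * (k + 1) : ℝ) * (D.card + R.card) + M.card + M.card := by
        refine le_trans ?_ (add_le_add_right hnum' _)
        exact_mod_cast hsep
      have hloss : (M.card : ℝ) - 2 * M.card * (1 / (k * (k + 1))) ≤ D.card + R.card := by
        have hq' : (0 : ℝ) < k * (k + 1) := by positivity
        rw [mul_one_div, sub_le_iff_le_add, ← sub_le_iff_le_add', le_div_iff₀ hq']
        linarith
      have hle : (D.card + R.card : ℝ) ≤ M.card := by
        have : D.card + R.card ≤ M.card := by
          rw [← Finset.card_union_of_disjoint hDR]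
          exact Finset.card_le_card (Finset.union_subset hDM hRM)
        exact_mod_cast this
      have hpos : 0 ≤ 1 / (k₀ : ℝ) - 1 / k :=
        sub_nonneg.2 (one_div_le_one_div_of_le (by exact_mod_cast hk₀) (by exact_mod_cast hk))
      have hmul := mul_le_mul_of_nonneg_right hle hpos
      push_cast at hdiff ⊢
      linear_combination hc₁ + hc₂ + hloss + 2 * hmul - 2 * (M.card : ℝ) * hdiff
    · have := edgesTouching_union hdisj fun x hx y hy => hadj x (hY₁ hx) y (hY₂ hy)
      rw [Finset.card_union_of_disjoint hdisj, mul_add]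
      omega

end Islands

lemma exists_forall_polynomial_le_pow (h N : ℕ) :
    ∃ k₀ ≥ N, ∀ k ≥ k₀, ((k * (k + 1) * (h * (1 + 2 * (k * (k + 1) * (k + 1)) * h)) : ℕ) : ℝ)
      ≤ (4 / 3 : ℝ) ^ k := by
  have hlim := (isLittleO_pow_const_const_pow_of_one_lt (R := ℝ) 5
    (by norm_num : (1 : ℝ) < 4 / 3)).bound (c := 1 / (36 * (h + 1) ^ 2)) (by positivity)
  obtain ⟨K, hK⟩ := Filter.eventually_atTop.1 hlim
  refine ⟨max (max K N) 1, by simp, fun k hk => ?_⟩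
  have hk1 : 1 ≤ k := le_trans (by simp) hk
  have := hK k (le_trans (by simp) hk)
  rw [Real.norm_of_nonneg (by positivity), Real.norm_of_nonneg (by positivity),
    div_mul_eq_mul_div, one_mul, le_div_iff₀ (by positivity)] at this
  refine le_trans ?_ this
  have : k * (k + 1) * (h * (1 + 2 * (k * (k + 1) * (k + 1)) * h)) ≤
      k ^ 5 * (36 * (h + 1) ^ 2) := by
    calc k * (k + 1) * (h * (1 + 2 * (k * (k + 1) * (k + 1)) * h))
        ≤ k * (k + k) * ((h + 1) * (k * k * k + 2 * (k * (k + k) * (k + k)) * (h + 1))) := by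
          gcongr
          · omega
          · have := Nat.mul_le_mul (Nat.mul_le_mul hk1 hk1) hk1
            simpa using this
          · omega
      _ = k ^ 5 * (2 * (h + 1) + 16 * (h + 1) ^ 2) := by ring
      _ ≤ k ^ 5 * (36 * (h + 1) ^ 2) := by
          gcongr
          nlinarith
  exact_mod_cast this

/-- for every graph `H`, integer `t ≥ 1` and real `α > 0` there is `C > 0`
such that every `H`-minor-free graph `G` with `|E(G)| < (t-α)|V(G)|` contains a `t`-island
of size at most `C`. -/
theorem stmt9 {W : Type} [Fintype W] (H : SimpleGraph W) (t : ℕ) (ht : 1 ≤ t)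
    (α : ℝ) (hα : 0 < α) :
    ∃ C : ℝ, 0 < C ∧ ∀ (V : Type) (_ : Fintype V) (G : SimpleGraph V),
      ¬ IsMinorOf H G → (G.edgeSet.ncard : ℝ) < ((t : ℝ) - α) * (Nat.card V) →
      ∃ S : Set V, IsIsland G t S ∧ (S.ncard : ℝ) ≤ C := by
  classical
  obtain ⟨N, hN⟩ := exists_nat_gt (2 * (t : ℝ) / α)
  obtain ⟨k₀, hk₀, hnum⟩ := exists_forall_polynomial_le_pow (Fintype.card W) (N + 1)
  refine ⟨(4 / 3 : ℝ) ^ k₀, by positivity, fun V _ G hminor hedges => ?_⟩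
  by_contra! hisl
  have hk₀pos : (0 : ℝ) < k₀ := by
    have : 0 < k₀ := by omega
    exact_mod_cast this
  obtain ⟨n, hn⟩ := pow_unbounded_of_one_lt (Fintype.card V : ℝ) (by norm_num : (1 : ℝ) < 4 / 3)
  have hcard : ((Finset.univ : Finset V).card : ℝ) ≤ (4 / 3 : ℝ) ^ max k₀ n :=
    hn.le.trans (pow_le_pow_right₀ (by norm_num) (le_max_right _ _))
  obtain ⟨Y, -, hY, hYe⟩ := exists_mul_card_le_edgesTouching (t := t) (by omega) hnum
    (fun 𝒜 h𝒜 => lt_of_not_ge fun hle => hminor (h𝒜.isMinorOf H hle))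
    (fun S hS hSi => absurd (hisl S hSi) (by simpa using hS)) (le_max_left k₀ n)
    Finset.univ hcard
  have hle : edgesTouching G (Y : Set V) ≤ G.edgeSet.ncard :=
    Set.ncard_le_ncard (fun e he => he.1) (Set.toFinite _)
  have hlow : (t : ℝ) * Y.card ≤ G.edgeSet.ncard := by exact_mod_cast hYe.trans hle
  rw [Finset.card_univ] at hY
  rw [Nat.card_eq_fintype_card] at hedges
  have hloss : 2 * (t : ℝ) * (1 / k₀ - 1 / (max k₀ n : ℕ)) ≤ α := by
    have h1 : 2 * (t : ℝ) * (1 / k₀) ≤ α := by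
      rw [mul_one_div, div_le_iff₀ hk₀pos, mul_comm α, ← div_le_iff₀ hα]
      refine hN.le.trans ?_
      exact_mod_cast (by omega : N ≤ k₀)
    have h2 : 0 ≤ 2 * (t : ℝ) * (1 / (max k₀ n : ℕ)) := by positivity
    linarith
  have h1 := mul_le_mul_of_nonneg_left hY (Nat.cast_nonneg (α := ℝ) t)
  have h2 := mul_le_mul_of_nonneg_left hloss (Nat.cast_nonneg (α := ℝ) (Fintype.card V))
  linarith
end
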